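/- arXiv:2510.04119 — 2 statements merged into one kernel-verified Lean document; each statement's English description precedes it below -/
import Mathlib

section
/- (Schur complement theorem for quantum Berezinians) Write M in block form M = (M_{11}, M_{12}; M_{21}, M_{22}) with M_{11} of size k\times k and M_{22} of size (m+n-k)\times(m+n-k), where k \le m or k \ge m. Then Ber_q(M) = Ber_q(M_{11}) \cdot Ber_q(M_{22} - M_{21} M_{11}^{-1} M_{12}). -/
open scoped BigOperators Classical
open Finset

namespace QSM

/-- Parity of a basis index of `ℂ^{m|n}`: `0` (even) for indices `< m`, `1` (odd) otherwise. -/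
def pa (m : ℕ) {N : ℕ} (i : Fin N) : ℕ := if (i : ℕ) < m then 0 else 1

/-- The sign `ε(i - j)`: `1` if `i > j`, `0` if `i = j`, `-1` if `i < j`. -/
def eps {N : ℕ} (i j : Fin N) : ℤ :=
  if (j : ℕ) < (i : ℕ) then 1 else if (i : ℕ) < (j : ℕ) then -1 else 0

variable {B : Type*} [Ring B] [Algebra ℂ B]

/-- Map a complex matrix into a matrix over the `ℂ`-algebra `B`. -/
noncomputable def cmap {I : Type*} (X : Matrix I I ℂ) : Matrix I I B :=
  X.map (algebraMap ℂ B)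

/-- The super tensor product `E_{ij} ⊗ E_{kl}` of matrix units, as an operator on the
graded tensor square of `ℂ^{m|n}` (super sign conventions). -/
noncomputable def stu (m : ℕ) {N : ℕ} (i j k l : Fin N) :
    Matrix (Fin N × Fin N) (Fin N × Fin N) ℂ :=
  Matrix.of fun p r =>
    ((-1 : ℂ) ^ ((pa m k + pa m l) * pa m r.1)) *
      (if p.1 = i ∧ r.1 = j then 1 else 0) * (if p.2 = k ∧ r.2 = l then 1 else 0)

/-- The operator `P^q = ∑_{i,j} q^{ε(i-j)} (-1)^{\bar j} E_{ij} ⊗ E_{ji}` on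
`(ℂ^{m|n})^{⊗2}`. -/
noncomputable def Pq (q : ℂ) (m : ℕ) {N : ℕ} : Matrix (Fin N × Fin N) (Fin N × Fin N) ℂ :=
  ∑ i : Fin N, ∑ j : Fin N, (q ^ eps i j * (-1 : ℂ) ^ pa m j) • stu m i j j i

/-- `M₁ = ∑ (-1)^{\bar i\bar j+\bar j} M_{ij} ⊗ E_{ij} ⊗ 1` on the tensor square. -/
noncomputable def Mone (m : ℕ) {N : ℕ} (M : Matrix (Fin N) (Fin N) B) :
    Matrix (Fin N × Fin N) (Fin N × Fin N) B :=
  Matrix.of fun p r =>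
    if p.2 = r.2 then
      ((-1 : ℂ) ^ (pa m p.1 * pa m r.1 + pa m r.1)) • M p.1 r.1
    else 0

/-- `M₂ = ∑ (-1)^{\bar i\bar j+\bar j} M_{ij} ⊗ 1 ⊗ E_{ij}` on the tensor square
(with the super sign of `1 ⊗ E_{ij}`). -/
noncomputable def Mtwo (m : ℕ) {N : ℕ} (M : Matrix (Fin N) (Fin N) B) :
    Matrix (Fin N × Fin N) (Fin N × Fin N) B :=
  Matrix.of fun p r =>
    if p.1 = r.1 then
      ((-1 : ℂ) ^ (pa m p.2 * pa m r.2 + pa m r.2 + (pa m p.2 + pa m r.2) * pa m r.1)) •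
        M p.2 r.2
    else 0

/-- The `q`-super Manin matrix condition in matrix form:
`(1 - P^q) M₁ M₂ (1 + P^q) = 0`. -/
def IsManin (q : ℂ) (m : ℕ) {N : ℕ} (M : Matrix (Fin N) (Fin N) B) : Prop :=
  (1 - cmap (Pq q m)) * Mone m M * Mtwo m M * (1 + cmap (Pq q m)) = 0

/-- The entrywise relations of the right quantum superalgebra `𝓜_{m|n}`. -/
def ManinRel (q : ℂ) (m : ℕ) {N : ℕ} (M : Matrix (Fin N) (Fin N) B) : Prop :=
  (∀ i j, pa m i = 1 → pa m j = 0 → M i j * M i j = 0) ∧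
  (∀ i k l, pa m i = 1 →
    M i k * M i l = (q ^ eps l k * (-1 : ℂ) ^ ((pa m k + 1) * (pa m l + 1))) • (M i l * M i k)) ∧
  (∀ i j k, pa m k = 0 →
    M i k * M j k = (q ^ eps i j * (-1 : ℂ) ^ (pa m i * pa m j)) • (M j k * M i k)) ∧
  (∀ i j k l,
    M i j * M k l -
        (q ^ (eps i k + eps l j) * (-1 : ℂ) ^ ((pa m i + pa m j) * (pa m k + pa m l))) •
          (M k l * M i j)
      = (q ^ eps i k * (-1 : ℂ) ^ (pa m i * pa m k + pa m j * pa m k + pa m i * pa m j)) •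
            (M k j * M i l)
        - (q ^ eps l j * (-1 : ℂ) ^ (pa m j * pa m k + pa m j * pa m l + pa m k * pa m l)) •
            (M i l * M k j))

/-- The operator `P^q_σ` on `(ℂ^{m|n})^{⊗k}` (defined via reduced decompositions of `σ`;
equivalently, by the explicit inversion formula used here). -/
noncomputable def Pperm (q : ℂ) (m : ℕ) {N k : ℕ} (σ : Equiv.Perm (Fin k)) :
    Matrix (Fin k → Fin N) (Fin k → Fin N) ℂ :=
  Matrix.of fun f g =>
    if f = g ∘ ⇑σ⁻¹ then
      ∏ p ∈ Finset.univ.filter (fun p : Fin k × Fin k => p.1 < p.2 ∧ σ p.2 < σ p.1),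
        (q ^ eps (g p.1) (g p.2) * (-1 : ℂ) ^ (pa m (g p.1) * pa m (g p.2)))
    else 0

/-- The `q`-antisymmetrizer over the tensor positions in `S`. -/
noncomputable def AqS (q : ℂ) (m : ℕ) {N k : ℕ} (S : Finset (Fin k)) :
    Matrix (Fin k → Fin N) (Fin k → Fin N) ℂ :=
  (S.card.factorial : ℂ)⁻¹ •
    ∑ σ ∈ Finset.univ.filter (fun σ : Equiv.Perm (Fin k) => ∀ t ∉ S, σ t = t),
      (((Equiv.Perm.sign σ : ℤ) : ℂ)) • Pperm q m (N := N) σ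

/-- The `q`-symmetrizer over the tensor positions in `S`. -/
noncomputable def HqS (q : ℂ) (m : ℕ) {N k : ℕ} (S : Finset (Fin k)) :
    Matrix (Fin k → Fin N) (Fin k → Fin N) ℂ :=
  (S.card.factorial : ℂ)⁻¹ •
    ∑ σ ∈ Finset.univ.filter (fun σ : Equiv.Perm (Fin k) => ∀ t ∉ S, σ t = t),
      Pperm q m (N := N) σ

/-- `M_a`: the copy of `M` in the `a`-th slot of `B ⊗ End(ℂ^{m|n})^{⊗k}`, with the super
sign factors `(-1)^{\bar i\bar j+\bar j}` and the super signs of `1⊗⋯⊗E_{ij}⊗⋯⊗1`. -/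
noncomputable def Mslot (m : ℕ) {N k : ℕ} (M : Matrix (Fin N) (Fin N) B) (a : Fin k) :
    Matrix (Fin k → Fin N) (Fin k → Fin N) B :=
  Matrix.of fun f g =>
    if ∀ b, b ≠ a → f b = g b then
      ((-1 : ℂ) ^ (pa m (f a) * pa m (g a) + pa m (g a)
          + (pa m (f a) + pa m (g a)) *
              ∑ b ∈ Finset.univ.filter (fun b => b < a), pa m (g b))) •
        M (f a) (g a)
    else 0

/-- The product `M₁ M₂ ⋯ M_k`. -/
noncomputable def MProd (m : ℕ) {N : ℕ} (M : Matrix (Fin N) (Fin N) B) (k : ℕ) :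
    Matrix (Fin k → Fin N) (Fin k → Fin N) B :=
  (List.ofFn fun a : Fin k => Mslot m M a).prod

/-- The `q`-super Manin condition in the form `𝒜₂^q M₁ M₂ ℋ₂^q = 0`. -/
def IsManin2 (q : ℂ) (m : ℕ) {N : ℕ} (M : Matrix (Fin N) (Fin N) B) : Prop :=
  cmap (AqS q m (Finset.univ : Finset (Fin 2))) * Mslot m M (0 : Fin 2) *
      Mslot m M (1 : Fin 2) * cmap (HqS q m (Finset.univ : Finset (Fin 2))) = 0

/-- The supertrace `str_{1,…,k}` over all `k` tensor slots. -/
noncomputable def strAll (m : ℕ) {N k : ℕ}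
    (X : Matrix (Fin k → Fin N) (Fin k → Fin N) B) : B :=
  ∑ f : Fin k → Fin N, ((-1 : ℂ) ^ (∑ t, pa m (f t))) • X f f

/-- The supertrace of an `N × N` matrix. -/
noncomputable def strM (m : ℕ) {N : ℕ} (X : Matrix (Fin N) (Fin N) B) : B :=
  ∑ i, ((-1 : ℂ) ^ pa m i) • X i i

/-- The star product `B * C = str₁ (P^q_{12} B₁ C₂)`. -/
noncomputable def starMul (q : ℂ) (m : ℕ) {N : ℕ} (X Y : Matrix (Fin N) (Fin N) B) :
    Matrix (Fin N) (Fin N) B :=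
  Matrix.of fun i j =>
    ((-1 : ℂ) ^ (pa m i * pa m j + pa m j)) •
      ∑ a : Fin N, ((-1 : ℂ) ^ (pa m a * (1 + pa m i + pa m j))) •
        ((cmap (Pperm q m (Equiv.swap (0 : Fin 2) 1)) * Mslot m X (0 : Fin 2) *
            Mslot m Y (1 : Fin 2) :
          Matrix (Fin 2 → Fin N) (Fin 2 → Fin N) B) ![a, i] ![a, j])

/-- The powers `M^{[k]}` of `M` with respect to the star product. -/
noncomputable def Mpow (q : ℂ) (m : ℕ) {N : ℕ} (M : Matrix (Fin N) (Fin N) B) :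
    ℕ → Matrix (Fin N) (Fin N) B
  | 0 => 1
  | 1 => M
  | (j + 2) => starMul q m (Mpow q m M (j + 1)) M

/-- Coefficient of `t^k` in `A(t) = ∑ (-t)^k str_{1,…,k}(𝒜_k^q M₁⋯M_k)`. -/
noncomputable def coefA (q : ℂ) (m : ℕ) {N : ℕ} (M : Matrix (Fin N) (Fin N) B) (k : ℕ) : B :=
  ((-1 : ℂ) ^ k) •
    strAll m (cmap (AqS q m (Finset.univ : Finset (Fin k))) * MProd m M k)

/-- Coefficient of `t^k` in `S(t) = ∑ t^k str_{1,…,k}(ℋ_k^q M₁⋯M_k)`. -/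
noncomputable def coefS (q : ℂ) (m : ℕ) {N : ℕ} (M : Matrix (Fin N) (Fin N) B) (k : ℕ) : B :=
  strAll m (cmap (HqS q m (Finset.univ : Finset (Fin k))) * MProd m M k)

/-- Coefficient of `t^k` in `T(t) = ∑ t^k str(M^{[k+1]})`. -/
noncomputable def coefT (q : ℂ) (m : ℕ) {N : ℕ} (M : Matrix (Fin N) (Fin N) B) (k : ℕ) : B :=
  strM m (Mpow q m M (k + 1))

/-- Coefficients `M^{i_1…i_k}_{j_1…j_k}` of `𝒜_k^q M₁⋯M_k` in the basis
`E_{i_1j_1} ⊗ ⋯ ⊗ E_{i_kj_k}` (super sign conventions). -/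
noncomputable def MIJ (q : ℂ) (m : ℕ) {N k : ℕ} (M : Matrix (Fin N) (Fin N) B)
    (f g : Fin k → Fin N) : B :=
  ((-1 : ℂ) ^ (∑ a : Fin k, (pa m (f a) + pa m (g a)) *
      ∑ b ∈ Finset.univ.filter (fun b => b < a), pa m (g b))) •
    ((cmap (AqS q m (Finset.univ : Finset (Fin k))) * MProd m M k :
      Matrix (Fin k → Fin N) (Fin k → Fin N) B) f g)

/-- Number of inversions (the length `l(σ)`) of a permutation. -/
def invCount {r : ℕ} (σ : Equiv.Perm (Fin r)) : ℕ :=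
  (Finset.univ.filter fun p : Fin r × Fin r => p.1 < p.2 ∧ σ p.2 < σ p.1).card

/-- The quantum determinant `det_q(A) = ∑_σ (-q)^{-l(σ)} A_{σ(1),1} ⋯ A_{σ(r),r}`. -/
noncomputable def detq (q : ℂ) {r : ℕ} (A : Matrix (Fin r) (Fin r) B) : B :=
  ∑ σ : Equiv.Perm (Fin r),
    ((-q) ^ (-(invCount σ : ℤ))) • (List.ofFn fun i : Fin r => A (σ i) i).prod

/-- The quantum Berezinian of a type `(r|s)` matrix `A` with (two-sided) inverse `Ainv`. -/
noncomputable def Ber (q : ℂ) (r s : ℕ) (A Ainv : Matrix (Fin (r + s)) (Fin (r + s)) B) : B :=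
  (∑ σ : Equiv.Perm (Fin r), ((-q) ^ (-(invCount σ : ℤ))) •
      (List.ofFn fun i : Fin r => A (Fin.castAdd s (σ i)) (Fin.castAdd s i)).prod) *
  (∑ ρ : Equiv.Perm (Fin s), ((-q) ^ (-(invCount ρ : ℤ))) •
      (List.ofFn fun j : Fin s => Ainv (Fin.natAdd r j) (Fin.natAdd r (ρ j))).prod)

/-- The `Π ∘ st` transform of a type `(r'|s')` matrix: a type `(s'|r')` matrix. -/
noncomputable def PiSt (r' s' : ℕ) (A : Matrix (Fin (r' + s')) (Fin (r' + s')) B) :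
    Matrix (Fin (s' + r')) (Fin (s' + r')) B :=
  Matrix.of fun i j =>
    ((-1 : ℂ) ^ (pa s' i * (pa s' i + pa s' j))) •
      A (Fin.rev (Fin.cast (Nat.add_comm s' r') j)) (Fin.rev (Fin.cast (Nat.add_comm s' r') i))

/-- Left corner embedding `Fin a → Fin b`. -/
def embL (a b : ℕ) (h : a ≤ b) : Fin a → Fin b :=
  fun i => ⟨(i : ℕ), lt_of_lt_of_le i.isLt h⟩

/-- Embedding of `Fin a` into `Fin b` shifted by `c`. -/
def embR (c a b : ℕ) (h : c + a ≤ b) : Fin a → Fin b :=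
  fun i => ⟨c + (i : ℕ), by have := i.isLt; omega⟩

/-- `P^q ⊗ 1` on the triple tensor space. -/
noncomputable def P12 (q : ℂ) (m : ℕ) {N : ℕ} :
    Matrix (Fin N × Fin N × Fin N) (Fin N × Fin N × Fin N) ℂ :=
  Matrix.of fun p r =>
    Pq q m (p.1, p.2.1) (r.1, r.2.1) * (if p.2.2 = r.2.2 then 1 else 0)

/-- `1 ⊗ P^q` on the triple tensor space (no extra super sign: `P^q` is even). -/
noncomputable def P23 (q : ℂ) (m : ℕ) {N : ℕ} :
    Matrix (Fin N × Fin N × Fin N) (Fin N × Fin N × Fin N) ℂ :=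
  Matrix.of fun p r =>
    (if p.1 = r.1 then 1 else 0) * Pq q m (p.2.1, p.2.2) (r.2.1, r.2.2)

/-- Right multiplication of `w = ∑ ψ_J w_J` by `∑ ψ_i v_i` in the `q`-Grassmann algebra with
generators `ψ_i`, in terms of coordinates. -/
noncomputable def grStep (q : ℂ) {n : ℕ} (v : Fin n → B) (w : Finset (Fin n) → B) :
    Finset (Fin n) → B :=
  fun J => ∑ i ∈ J, ((-q) ^ (-((J.filter (i < ·)).card : ℤ))) • (w (J.erase i) * v i)

/-- The product of `∑ ψ_i v_{t,i}` over `t` in the `q`-Grassmann algebra, in coordinates. -/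
noncomputable def wedge (q : ℂ) {n : ℕ} :
    (r : ℕ) → (Fin r → Fin n → B) → Finset (Fin n) → B
  | 0, _ => fun J => if J = ∅ then 1 else 0
  | r + 1, v => grStep q (v (Fin.last r)) (wedge q r fun t => v t.castSucc)

/-- The number of inversions of a function. -/
def finvCount {r n : ℕ} (f : Fin r → Fin n) : ℕ :=
  (Finset.univ.filter fun p : Fin r × Fin r => p.1 < p.2 ∧ f p.2 < f p.1).card

lemma finvCount_snoc {r n : ℕ} (f : Fin r → Fin n) (i : Fin n) :
    finvCount (Fin.snoc f i : Fin (r + 1) → Fin n) =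
      finvCount f + (Finset.univ.filter fun t => i < f t).card := by
  unfold finvCount
  simp only [Finset.card_filter, Fintype.sum_prod_type]
  rw [Fin.sum_univ_castSucc]
  simp only [Fin.sum_univ_castSucc, Fin.snoc_castSucc, Fin.snoc_last, Fin.castSucc_lt_castSucc_iff,
    Fin.castSucc_lt_last, lt_irrefl, Finset.sum_add_distrib]
  have h (t : Fin r) : ¬ Fin.last r < t.castSucc := (Fin.castSucc_lt_last t).le.not_gt
  simp [h]

lemma snoc_injective_and_image_iff {r n : ℕ} (f : Fin r → Fin n) (i : Fin n)
    (J : Finset (Fin n)) :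
    (Function.Injective (Fin.snoc f i : Fin (r + 1) → Fin n) ∧
        Finset.univ.image (Fin.snoc f i : Fin (r + 1) → Fin n) = J) ↔
      i ∈ J ∧ Function.Injective f ∧ Finset.univ.image f = J.erase i := by
  have himage : Finset.univ.image (Fin.snoc f i : Fin (r + 1) → Fin n) =
      insert i (Finset.univ.image f) := by
    ext x
    simp [Fin.exists_fin_succ', eq_comm, or_comm]
  rw [himage]
  constructor
  · rintro ⟨hf, rfl⟩
    have hi : i ∉ Finset.univ.image f := by
      simp only [Finset.mem_image, Finset.mem_univ, true_and, not_exists]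
      intro t ht
      have : t.castSucc = Fin.last r := hf (by simpa using ht)
      exact (Fin.castSucc_lt_last t).ne this
    refine ⟨Finset.mem_insert_self _ _, fun s t hst => ?_, (Finset.erase_insert hi).symm⟩
    exact Fin.castSucc_injective _ (hf (by simpa using hst))
  · rintro ⟨hi, hf, hJ⟩
    refine ⟨Fin.snoc_injective_of_injective hf ?_, by rw [hJ, Finset.insert_erase hi]⟩
    rintro ⟨t, rfl⟩
    have : f t ∈ J.erase (f t) := hJ ▸ Finset.mem_image_of_mem f (Finset.mem_univ t)
    simp at this

lemma wedge_eq_sum (q : ℂ) (hq : q ≠ 0) {n : ℕ} (r : ℕ) (v : Fin r → Fin n → B)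
    (J : Finset (Fin n)) :
    wedge q r v J = ∑ f : Fin r → Fin n,
      if Function.Injective f ∧ Finset.univ.image f = J then
        ((-q) ^ (-(finvCount f : ℤ))) • (List.ofFn fun t => v t (f t)).prod else 0 := by
  induction r generalizing J with
  | zero =>
    have : Function.Injective (default : Fin 0 → Fin n) := fun a => a.elim0
    rw [Fintype.sum_unique]
    simp [wedge, finvCount, this, eq_comm]
  | succ r ih =>
    rw [← (Fin.snocEquiv fun _ : Fin (r + 1) => Fin n).sum_comp, Fintype.sum_prod_type]
    simp only [wedge, grStep]
    rw [← Finset.sum_subset (Finset.subset_univ J)]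
    · refine Finset.sum_congr rfl fun i hi => ?_
      rw [ih, Finset.sum_mul, Finset.smul_sum]
      refine Finset.sum_congr rfl fun f _ => ?_
      change _ = if Function.Injective (Fin.snoc f i : Fin (r + 1) → Fin n) ∧
        Finset.univ.image (Fin.snoc f i : Fin (r + 1) → Fin n) = J then
          ((-q) ^ (-(finvCount (Fin.snoc f i : Fin (r + 1) → Fin n) : ℤ))) •
            (List.ofFn fun t => v t ((Fin.snoc f i : Fin (r + 1) → Fin n) t)).prod else 0
      simp only [snoc_injective_and_image_iff, hi, true_and]
      split_ifs with h
      · have hcard : (Finset.univ.filter fun t => i < f t).card = (J.filter (i < ·)).card := by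
          have h1 : J.filter (i < ·) = (J.erase i).filter (i < ·) := by
            ext x
            simp only [Finset.mem_filter, Finset.mem_erase]
            exact ⟨fun hx => ⟨⟨hx.2.ne', hx.1⟩, hx.2⟩, fun hx => ⟨hx.1.2, hx.2⟩⟩
          rw [h1, ← h.2, Finset.filter_image, Finset.card_image_of_injective _ h.1]
        rw [finvCount_snoc, hcard, List.ofFn_succ', List.concat_eq_append, List.prod_append]
        simp only [Fin.snoc_castSucc, Fin.snoc_last, List.prod_cons, List.prod_nil, mul_one,
          smul_mul_assoc, smul_smul]
        rw [← zpow_add₀ (neg_ne_zero.mpr hq)]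
        congr 2
        push_cast
        ring
      · simp
    · intro i _ hi
      refine Finset.sum_eq_zero fun f _ => if_neg fun h => hi ?_
      exact ((snoc_injective_and_image_iff f i J).1 h).1

lemma wedge_univ (q : ℂ) (hq : q ≠ 0) {n : ℕ} (X : Matrix (Fin n) (Fin n) B) :
    wedge q n (fun t i => X i t) Finset.univ = detq q X := by
  rw [wedge_eq_sum q hq, ← Finset.sum_filter, detq]
  symm
  refine Finset.sum_bij (fun σ _ => ⇑σ) ?_ ?_ ?_ ?_
  · intro σ _
    simp [σ.injective]
  · intro σ _ τ _ h
    exact DFunLike.coe_injective h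
  · intro f hf
    simp only [Finset.mem_filter, Finset.mem_univ, true_and] at hf
    exact ⟨Equiv.ofBijective f (Finite.injective_iff_bijective.1 hf.1), Finset.mem_univ _, rfl⟩
  · intro σ _
    rfl

lemma grStep_grStep (q : ℂ) (hq : q ≠ 0) {n : ℕ} (u v : Fin n → B) (w : Finset (Fin n) → B)
    (J : Finset (Fin n)) :
    grStep q u (grStep q v w) J = ∑ i ∈ J, ∑ j ∈ J, if i < j then
      ((-q) ^ (-((J.filter (i < ·)).card + (J.filter (j < ·)).card : ℤ))) •
        (w ((J.erase i).erase j) * (v j * u i - q • (v i * u j))) else 0 := by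
  have hq' := neg_ne_zero.mpr hq
  have hL : grStep q u (grStep q v w) J = ∑ j ∈ J, ∑ i ∈ J,
      ((if i < j then ((-q) ^ (-((J.filter (i < ·)).card + (J.filter (j < ·)).card : ℤ) + 1)) •
          (w ((J.erase i).erase j) * (v i * u j)) else 0) +
        if j < i then ((-q) ^ (-((J.filter (j < ·)).card + (J.filter (i < ·)).card : ℤ))) •
          (w ((J.erase j).erase i) * (v i * u j)) else 0) := by
    simp only [grStep]
    refine Finset.sum_congr rfl fun j hj => ?_
    rw [Finset.sum_mul, Finset.smul_sum, ← Finset.sum_subset (Finset.erase_subset j J)]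
    · refine Finset.sum_congr rfl fun i hi => ?_
      obtain ⟨hij, hi⟩ := Finset.mem_erase.1 hi
      rw [smul_mul_assoc, smul_smul, ← zpow_add₀ hq', mul_assoc]
      rcases lt_or_gt_of_ne hij with h | h
      · rw [if_pos h, if_neg h.le.not_gt, add_zero, Finset.erase_right_comm]
        have : (J.filter (i < ·)).card = ((J.erase j).filter (i < ·)).card + 1 := by
          rw [Finset.filter_erase, Finset.card_erase_add_one]
          simp [hj, h]
        rw [this]
        congr 2
        push_cast
        ring
      · rw [if_neg h.le.not_gt, if_pos h, zero_add]
        have : (J.erase j).filter (i < ·) = J.filter (i < ·) := by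
          rw [Finset.filter_erase, Finset.erase_eq_of_notMem]
          simp [h.le]
        rw [this]
        congr 2
        ring
    · intro i hi hi'
      obtain rfl : i = j := by
        by_contra h
        exact hi' (Finset.mem_erase.2 ⟨h, hi⟩)
      simp
  rw [hL]
  simp only [Finset.sum_add_distrib]
  rw [Finset.sum_comm, ← Finset.sum_add_distrib]
  refine Finset.sum_congr rfl fun i _ => ?_
  rw [← Finset.sum_add_distrib]
  refine Finset.sum_congr rfl fun j _ => ?_
  split_ifs with h
  · rw [zpow_add₀ hq', zpow_one, mul_sub, smul_sub, mul_smul, mul_smul_comm, neg_smul, smul_neg]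
    abel
  · simp

lemma grStep_grStep_congr (q : ℂ) (hq : q ≠ 0) {n : ℕ} {u v u' v' : Fin n → B} (c : ℂ)
    (h : ∀ i j, i < j → v j * u i - q • (v i * u j) = c • (v' j * u' i - q • (v' i * u' j)))
    (w : Finset (Fin n) → B) :
    grStep q u (grStep q v w) = c • grStep q u' (grStep q v' w) := by
  funext J
  rw [Pi.smul_apply, grStep_grStep q hq, grStep_grStep q hq]
  simp only [Finset.smul_sum, smul_ite, smul_zero]
  refine Finset.sum_congr rfl fun i _ => Finset.sum_congr rfl fun j _ => ?_
  split_ifs with hij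
  · rw [h i j hij, mul_smul_comm, smul_comm]
  · rfl

lemma grStep_zero (q : ℂ) {n : ℕ} (v : Fin n → B) : grStep q v 0 = 0 := by
  funext J
  simp [grStep]

lemma grStep_sub_sum (q : ℂ) {n : ℕ} {ι : Type*} (s : Finset ι) (v : Fin n → B)
    (φ : ι → Fin n → B) (c : ι → B) (w : Finset (Fin n) → B)
    (h : ∀ a ∈ s, grStep q (φ a) w = 0) :
    grStep q (fun i => v i - ∑ a ∈ s, φ a i * c a) w = grStep q v w := by
  funext J
  have hz : ∑ a ∈ s, grStep q (φ a) w J * c a = 0 :=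
    Finset.sum_eq_zero fun a ha => by simp [h a ha]
  rw [← sub_zero (grStep q v w J), ← hz]
  simp only [grStep, mul_sub, smul_sub, Finset.sum_sub_distrib, Finset.mul_sum, Finset.smul_sum,
    Finset.sum_mul, smul_mul_assoc, mul_assoc]
  rw [Finset.sum_comm]

/-- The relations of an (even) `q`-Manin matrix. -/
def IsQManin (q : ℂ) {n : ℕ} (X : Matrix (Fin n) (Fin n) B) : Prop :=
  (∀ i j k, X i k * X j k = q ^ eps i j • (X j k * X i k)) ∧
  ∀ i j k l, X i j * X k l - q ^ (eps i k + eps l j) • (X k l * X i j) =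
    q ^ eps i k • (X k j * X i l) - q ^ eps l j • (X i l * X k j)

lemma IsQManin.grStep_self {q : ℂ} (hq : q ≠ 0) {n : ℕ} {X : Matrix (Fin n) (Fin n) B}
    (hX : IsQManin q X) (a : Fin n) (w : Finset (Fin n) → B) :
    grStep q (fun i => X i a) (grStep q (fun i => X i a) w) = 0 := by
  rw [grStep_grStep_congr q hq (u' := 0) (v' := 0) 0, zero_smul]
  intro i j hij
  have := hX.1 j i a
  rw [eps, if_pos (by exact hij), zpow_one] at this
  rw [this, sub_self, zero_smul]

lemma IsQManin.grStep_comm {q : ℂ} (hq : q ≠ 0) {n : ℕ} {X : Matrix (Fin n) (Fin n) B}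
    (hX : IsQManin q X) (a b : Fin n) :
    ∃ c : ℂ, ∀ w : Finset (Fin n) → B,
      grStep q (fun i => X i a) (grStep q (fun i => X i b) w) =
        c • grStep q (fun i => X i b) (grStep q (fun i => X i a) w) := by
  have key : ∀ a b : Fin n, a < b → ∀ i j : Fin n, i < j →
      X j b * X i a - q • (X i b * X j a) = (-q⁻¹) • (X j a * X i b - q • (X i a * X j b)) := by
    intro a b hab i j hij
    have h := hX.2 i a j b
    have e1 : eps i j = -1 := by
      have h' : (i : ℕ) < j := hij
      rw [eps, if_neg h'.le.not_gt, if_pos h']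
    have e2 : eps b a = 1 := by
      have h' : (a : ℕ) < b := hab
      simp [eps, h']
    rw [e1, e2, neg_add_cancel, zpow_zero, zpow_neg_one, zpow_one, one_smul] at h
    have h' : X j b * X i a = X i a * X j b - (q⁻¹ • (X j a * X i b) - q • (X i b * X j a)) := by
      rw [← h]
      abel
    rw [h', smul_sub, smul_smul, neg_smul, neg_mul, inv_mul_cancel₀ hq, neg_smul, one_smul]
    abel
  rcases lt_trichotomy a b with h | rfl | h
  · exact ⟨-q⁻¹, grStep_grStep_congr q hq _ (key a b h)⟩
  · exact ⟨1, fun w => (one_smul _ _).symm⟩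
  · refine ⟨-q, grStep_grStep_congr q hq _ fun i j hij => ?_⟩
    rw [key b a h i j hij, smul_smul, neg_mul_neg, mul_inv_cancel₀ hq, one_smul]

lemma grStep_smul (q : ℂ) {n : ℕ} (v : Fin n → B) (c : ℂ) (w : Finset (Fin n) → B) :
    grStep q v (c • w) = c • grStep q v w := by
  funext J
  simp only [grStep, Pi.smul_apply, Finset.smul_sum, smul_mul_assoc]
  exact Finset.sum_congr rfl fun i _ => smul_comm _ _ _

lemma IsQManin.grStep_wedge {q : ℂ} (hq : q ≠ 0) {n : ℕ} {X : Matrix (Fin n) (Fin n) B}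
    (hX : IsQManin q X) (r : ℕ) (g : Fin r → Fin n) (t : Fin r) :
    grStep q (fun i => X i (g t)) (wedge q r fun s i => X i (g s)) = 0 := by
  induction r with
  | zero => exact t.elim0
  | succ r ih =>
    rw [wedge]
    induction t using Fin.lastCases with
    | last => exact hX.grStep_self hq _ _
    | cast t =>
      obtain ⟨c, hc⟩ := hX.grStep_comm hq (g t.castSucc) (g (Fin.last r))
      rw [hc, ih (fun s => g s.castSucc) t, grStep_zero, smul_zero]

/-- The quantum determinant is invariant under right multiplication by upper unitriangular
matrices. -/
lemma IsQManin.detq_sub_mul {q : ℂ} (hq : q ≠ 0) {n : ℕ} {X : Matrix (Fin n) (Fin n) B}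
    (hX : IsQManin q X) (C : Matrix (Fin n) (Fin n) B) (hC : ∀ i j, ¬ i < j → C i j = 0) :
    detq q (X - X * C) = detq q X := by
  rw [← wedge_univ q hq, ← wedge_univ q hq]
  have key : ∀ (r : ℕ) (h : r ≤ n),
      wedge q r (fun (t : Fin r) i => (X - X * C) i (t.castLE h)) =
        wedge q r fun (t : Fin r) i => X i (t.castLE h) := by
    intro r
    induction r with
    | zero => exact fun _ => rfl
    | succ r ih =>
      intro h
      have ih' := ih (Nat.le_of_succ_le h)
      simp only [wedge]
      change grStep q _
          (wedge q r fun (t : Fin r) i => (X - X * C) i (t.castLE (Nat.le_of_succ_le h))) =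
        grStep q _ (wedge q r fun (t : Fin r) i => X i (t.castLE (Nat.le_of_succ_le h)))
      rw [ih']
      have hcol : (fun i => (X - X * C) i ((Fin.last r).castLE h)) = fun i =>
          X i ((Fin.last r).castLE h) -
            ∑ a ∈ Finset.univ.filter (· < (Fin.last r).castLE h),
              X i a * C a ((Fin.last r).castLE h) := by
        funext i
        rw [Matrix.sub_apply, Matrix.mul_apply, Finset.sum_filter_of_ne]
        intro a _ ha
        by_contra hlt
        exact ha (by rw [hC _ _ hlt, mul_zero])
      rw [hcol, grStep_sub_sum q _ _ (fun a i => X i a)]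
      intro a ha
      have ha' : (a : ℕ) < r := by simpa [Fin.lt_def] using ha
      exact hX.grStep_wedge hq r (fun t => t.castLE _) ⟨a, ha'⟩
  have := congrFun (key n le_rfl) Finset.univ
  simpa using this

/-- The block diagonal permutation of `Fin (k + l)` built from permutations of the two parts. -/
def blockPerm {k l : ℕ} (σ : Equiv.Perm (Fin k)) (τ : Equiv.Perm (Fin l)) :
    Equiv.Perm (Fin (k + l)) :=
  finSumFinEquiv.permCongr (Equiv.Perm.sumCongr σ τ)

@[simp]
lemma blockPerm_castAdd {k l : ℕ} (σ : Equiv.Perm (Fin k)) (τ : Equiv.Perm (Fin l)) (i : Fin k) :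
    blockPerm σ τ (Fin.castAdd l i) = Fin.castAdd l (σ i) := by
  simp [blockPerm, Equiv.permCongr_apply]

@[simp]
lemma blockPerm_natAdd {k l : ℕ} (σ : Equiv.Perm (Fin k)) (τ : Equiv.Perm (Fin l)) (j : Fin l) :
    blockPerm σ τ (Fin.natAdd k j) = Fin.natAdd k (τ j) := by
  simp [blockPerm, Equiv.permCongr_apply]

lemma blockPerm_injective {k l : ℕ} :
    Function.Injective fun p : Equiv.Perm (Fin k) × Equiv.Perm (Fin l) => blockPerm p.1 p.2 :=
  fun _ _ h => Equiv.Perm.sumCongrHom_injective (finSumFinEquiv.permCongr.injective h)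

lemma invCount_blockPerm {k l : ℕ} (σ : Equiv.Perm (Fin k)) (τ : Equiv.Perm (Fin l)) :
    invCount (blockPerm σ τ) = invCount σ + invCount τ := by
  unfold invCount
  simp only [Finset.card_filter, Fintype.sum_prod_type, Fin.sum_univ_add, blockPerm_castAdd,
    blockPerm_natAdd]
  have h (i : Fin k) (j : Fin l) : ¬ Fin.natAdd k j < Fin.castAdd l i := by
    rw [Fin.lt_def, Fin.val_natAdd, Fin.val_castAdd]
    omega
  have h' (i j : Fin k) : Fin.castAdd l i < Fin.castAdd l j ↔ i < j := Iff.rfl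
  simp only [h, false_and, and_false, if_false, Finset.sum_const_zero, add_zero, zero_add,
    Fin.natAdd_lt_natAdd_iff, h']

lemma exists_eq_blockPerm {k l : ℕ} (σ : Equiv.Perm (Fin (k + l)))
    (h : ∀ j i, σ (Fin.natAdd k j) ≠ Fin.castAdd l i) : ∃ p q, blockPerm p q = σ := by
  have hr : ∀ j, ∃ j', σ (Fin.natAdd k j) = Fin.natAdd k j' := fun j => by
    have := h j
    revert this
    induction σ (Fin.natAdd k j) using Fin.addCases with
    | left i => exact fun hi => absurd rfl (hi i)
    | right j' => exact fun _ => ⟨j', rfl⟩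
  choose g hg using hr
  have hg_inj : Function.Injective g := fun a b hab =>
    Fin.natAdd_injective l k (σ.injective (by rw [hg, hg, hab]))
  have hg_surj := Finite.surjective_of_injective hg_inj
  have hmem : finSumFinEquiv.symm.permCongr σ ∈ (Equiv.Perm.sumCongrHom (Fin k) (Fin l)).range := by
    refine Equiv.Perm.mem_sumCongrHom_range_of_perm_mapsTo_inl ?_
    rintro _ ⟨i, rfl⟩
    rcases hx : finSumFinEquiv.symm.permCongr σ (Sum.inl i) with i' | j
    · exact ⟨i', rfl⟩
    · exfalso
      obtain ⟨j', rfl⟩ := hg_surj j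
      rw [Equiv.permCongr_apply, Equiv.symm_apply_eq, finSumFinEquiv_apply_right, ← hg] at hx
      have := σ.injective hx
      simp [Fin.ext_iff] at this
      omega
  obtain ⟨⟨p, τ⟩, hp⟩ := hmem
  refine ⟨p, τ, ?_⟩
  rw [blockPerm]
  change finSumFinEquiv.permCongr (Equiv.Perm.sumCongrHom _ _ (p, τ)) = σ
  rw [hp]
  ext
  simp [Equiv.permCongr_apply]

lemma detq_of_upper_block_zero (q : ℂ) (hq : q ≠ 0) {k l : ℕ}
    (X : Matrix (Fin (k + l)) (Fin (k + l)) B)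
    (hX : ∀ i j, X (Fin.castAdd l i) (Fin.natAdd k j) = 0) :
    detq q X = detq q (X.submatrix (Fin.castAdd l) (Fin.castAdd l)) *
      detq q (X.submatrix (Fin.natAdd k) (Fin.natAdd k)) := by
  simp only [detq]
  rw [Finset.sum_mul_sum, ← Fintype.sum_prod_type']
  symm
  refine Finset.sum_of_injOn (fun p : Equiv.Perm (Fin k) × Equiv.Perm (Fin l) =>
    blockPerm p.1 p.2) blockPerm_injective.injOn (by simp) ?_ ?_
  · intro σ _ hσ
    obtain ⟨j, i, hij⟩ : ∃ j i, σ (Fin.natAdd k j) = Fin.castAdd l i := by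
      by_contra! hcon
      obtain ⟨p, τ, rfl⟩ := exists_eq_blockPerm σ hcon
      exact hσ ⟨(p, τ), by simp, rfl⟩
    rw [List.prod_eq_zero, smul_zero]
    rw [List.mem_ofFn]
    exact ⟨Fin.natAdd k j, by rw [hij, hX]⟩
  · rintro ⟨σ, τ⟩ _
    have hprod : (List.ofFn fun t => X (blockPerm σ τ t) t) =
        (List.ofFn fun i => X (Fin.castAdd l (σ i)) (Fin.castAdd l i)) ++
          List.ofFn fun j => X (Fin.natAdd k (τ j)) (Fin.natAdd k j) := by
      rw [← List.ofFn_fin_append]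
      refine congrArg List.ofFn (funext fun t => ?_)
      induction t using Fin.addCases <;> simp
    simp only [invCount_blockPerm, hprod, List.prod_append]
    rw [smul_mul_smul_comm, ← zpow_add₀ (neg_ne_zero.mpr hq)]
    congr 2
    push_cast
    ring

/-- Schur's complement formula for quantum determinants of `q`-Manin matrices. -/
lemma IsQManin.detq_schur {q : ℂ} (hq : q ≠ 0) {k l : ℕ}
    {X : Matrix (Fin (k + l)) (Fin (k + l)) B} (hX : IsQManin q X) (V : Matrix (Fin k) (Fin k) B)
    (hV : X.submatrix (Fin.castAdd l) (Fin.castAdd l) * V = 1) :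
    detq q X = detq q (X.submatrix (Fin.castAdd l) (Fin.castAdd l)) *
      detq q (X.submatrix (Fin.natAdd k) (Fin.natAdd k) -
        X.submatrix (Fin.natAdd k) (Fin.castAdd l) * V *
          X.submatrix (Fin.castAdd l) (Fin.natAdd k)) := by
  set X12 := X.submatrix (Fin.castAdd l) (Fin.natAdd k) with hX12
  let C : Matrix (Fin (k + l)) (Fin (k + l)) B :=
    (Matrix.fromBlocks 0 (V * X12) 0 0).submatrix finSumFinEquiv.symm finSumFinEquiv.symm
  have hC11 : ∀ i j, C (Fin.castAdd l i) (Fin.castAdd l j) = 0 := fun i j => by simp [C]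
  have hC21 : ∀ i j, C (Fin.natAdd k i) (Fin.castAdd l j) = 0 := fun i j => by simp [C]
  have hC22 : ∀ i j, C (Fin.natAdd k i) (Fin.natAdd k j) = 0 := fun i j => by simp [C]
  have hC12 : ∀ i j, C (Fin.castAdd l i) (Fin.natAdd k j) = (V * X12) i j := fun i j => by
    simp [C]
  have hC : ∀ i j, ¬ i < j → C i j = 0 := by
    intro i j hij
    induction i using Fin.addCases with
    | left i =>
      induction j using Fin.addCases with
      | left j => exact hC11 i j
      | right j =>
        refine absurd ?_ hij
        rw [Fin.lt_def, Fin.val_natAdd, Fin.val_castAdd]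
        omega
    | right i =>
      induction j using Fin.addCases with
      | left j => exact hC21 i j
      | right j => exact hC22 i j
  have hXC : ∀ i j, (X * C) i (Fin.natAdd k j) =
      (X.submatrix id (Fin.castAdd l) * (V * X12)) i j := fun i j => by
    simp [Matrix.mul_apply (M := X), Matrix.mul_apply (M := X.submatrix id (Fin.castAdd l)),
      Fin.sum_univ_add, hC12, hC22]
  have hXC' : ∀ i j, (X * C) i (Fin.castAdd l j) = 0 := fun i j => by
    simp [Matrix.mul_apply, Fin.sum_univ_add, hC11, hC21]
  rw [← hX.detq_sub_mul hq C hC, detq_of_upper_block_zero q hq]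
  · congr 2
    · ext i j
      simp [hXC']
    · ext i j
      simp only [Matrix.submatrix_apply, Matrix.sub_apply, hXC, Matrix.mul_assoc]
      rfl
  · intro i j
    rw [Matrix.sub_apply, hXC]
    have : X.submatrix (Fin.castAdd l) (Fin.castAdd l) * (V * X12) = X12 := by
      rw [← Matrix.mul_assoc, hV, Matrix.one_mul]
    exact sub_eq_zero.2 (congrFun (congrFun this i) j).symm

/-- The row quantum determinant. -/
noncomputable def rdetq (q : ℂ) {r : ℕ} (Y : Matrix (Fin r) (Fin r) B) : B :=
  ∑ ρ : Equiv.Perm (Fin r),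
    ((-q) ^ (-(invCount ρ : ℤ))) • (List.ofFn fun j : Fin r => Y j (ρ j)).prod

/-- Reflection in the antidiagonal, with entries in the opposite ring. -/
def opFlip {R : Type*} {a b : ℕ} (Y : Matrix (Fin a) (Fin b) R) :
    Matrix (Fin b) (Fin a) Rᵐᵒᵖ :=
  Matrix.of fun i j => MulOpposite.op (Y j.rev i.rev)

lemma opFlip_mul {R : Type*} [Ring R] {a b c : ℕ} (X : Matrix (Fin a) (Fin b) R)
    (Y : Matrix (Fin b) (Fin c) R) :
    opFlip (X * Y) = opFlip Y * opFlip X := by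
  ext i j
  simp only [opFlip, Matrix.of_apply, Matrix.mul_apply, ← MulOpposite.op_mul, ← Finset.op_sum]
  exact congrArg MulOpposite.op
    (Equiv.sum_comp Fin.revPerm fun x => X j.rev x * Y x i.rev).symm

lemma opFlip_one {R : Type*} [Ring R] {a : ℕ} :
    opFlip (1 : Matrix (Fin a) (Fin a) R) = 1 := by
  ext i j
  simp only [opFlip, Matrix.of_apply, Matrix.one_apply, Fin.rev_inj, eq_comm (a := j)]
  split_ifs <;> simp

lemma invCount_rev {r : ℕ} (ρ : Equiv.Perm (Fin r)) :
    invCount (Fin.revPerm.permCongr ρ) = invCount ρ := by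
  unfold invCount
  refine Finset.card_bij (fun p _ => (p.2.rev, p.1.rev)) ?_ ?_ ?_
  · intro p hp
    simpa [Equiv.permCongr_apply] using hp
  · intro p _ p' _ h
    simpa [Prod.ext_iff, and_comm] using h
  · intro p hp
    refine ⟨(p.2.rev, p.1.rev), ?_, by simp⟩
    simpa [Equiv.permCongr_apply] using hp

lemma reverse_ofFn {α : Type*} {r : ℕ} (f : Fin r → α) :
    (List.ofFn f).reverse = List.ofFn fun i => f i.rev := by
  refine List.ext_getElem (by simp) fun i h1 h2 => ?_
  simp only [List.getElem_reverse, List.getElem_ofFn, List.length_ofFn]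
  congr 1
  ext
  simp [Fin.val_rev]
  omega

lemma detq_opFlip (q : ℂ) {r : ℕ} (Y : Matrix (Fin r) (Fin r) B) :
    detq q (opFlip Y) = MulOpposite.op (rdetq q Y) := by
  rw [detq, rdetq, ← Fin.revPerm.permCongr.sum_comp, Finset.op_sum]
  refine Finset.sum_congr rfl fun ρ _ => ?_
  rw [invCount_rev, MulOpposite.op_smul, MulOpposite.op_list_prod, List.map_ofFn, reverse_ofFn]
  simp [opFlip, Function.comp_def]

lemma detq_cast (q : ℂ) {r s : ℕ} (h : r = s) (X : Matrix (Fin s) (Fin s) B) :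
    detq q (X.submatrix (Fin.cast h) (Fin.cast h)) = detq q X := by
  subst h
  rfl

lemma eps_rev {r : ℕ} (i j : Fin r) : eps i.rev j.rev = - eps i j := by
  unfold eps
  simp only [Fin.val_rev]
  have := i.isLt
  have := j.isLt
  split_ifs <;> omega

/-- The relations satisfied by the odd-odd block of a `q⁻¹`-super Manin matrix. -/
def IsRowQManin (q : ℂ) {n : ℕ} (Y : Matrix (Fin n) (Fin n) B) : Prop :=
  (∀ i k l, Y i k * Y i l = q ^ (-eps l k) • (Y i l * Y i k)) ∧
  ∀ i j k l, Y i j * Y k l - q ^ (-(eps i k + eps l j)) • (Y k l * Y i j) =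
    q ^ (-eps l j) • (Y i l * Y k j) - q ^ (-eps i k) • (Y k j * Y i l)

lemma IsRowQManin.opFlip {q : ℂ} {n : ℕ} {Y : Matrix (Fin n) (Fin n) B} (hY : IsRowQManin q Y) :
    IsQManin q (opFlip Y) := by
  constructor
  · intro i j k
    have := hY.1 k.rev j.rev i.rev
    rw [eps_rev, neg_neg] at this
    exact congrArg MulOpposite.op this
  · intro i j k l
    have := hY.2 l.rev k.rev j.rev i.rev
    simp only [eps_rev, neg_add, neg_neg] at this
    rw [add_comm (eps i k)]
    exact congrArg MulOpposite.op this

/-- Schur's complement formula for row quantum determinants. -/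
lemma IsRowQManin.rdetq_schur {q : ℂ} (hq : q ≠ 0) {k l : ℕ}
    {Y : Matrix (Fin (k + l)) (Fin (k + l)) B} (hY : IsRowQManin q Y)
    (V : Matrix (Fin l) (Fin l) B)
    (hV : V * Y.submatrix (Fin.natAdd k) (Fin.natAdd k) = 1) :
    rdetq q Y = rdetq q (Y.submatrix (Fin.castAdd l) (Fin.castAdd l) -
        Y.submatrix (Fin.castAdd l) (Fin.natAdd k) * V *
          Y.submatrix (Fin.natAdd k) (Fin.castAdd l)) *
      rdetq q (Y.submatrix (Fin.natAdd k) (Fin.natAdd k)) := by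
  let X : Matrix (Fin (l + k)) (Fin (l + k)) Bᵐᵒᵖ :=
    (QSM.opFlip Y).submatrix (Fin.cast (add_comm l k)) (Fin.cast (add_comm l k))
  have hX : IsQManin q X :=
    ⟨fun i j k => hY.opFlip.1 _ _ _, fun i j k l => hY.opFlip.2 _ _ _ _⟩
  have hl : ∀ i : Fin l,
      (Fin.cast (add_comm l k) (Fin.castAdd k i)).rev = Fin.natAdd k i.rev := fun i => by
    ext
    simp [Fin.val_rev]
    omega
  have hk : ∀ i : Fin k,
      (Fin.cast (add_comm l k) (Fin.natAdd l i)).rev = Fin.castAdd l i.rev := fun i => by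
    ext
    simp [Fin.val_rev]
    omega
  have h11 : X.submatrix (Fin.castAdd k) (Fin.castAdd k) =
      QSM.opFlip (Y.submatrix (Fin.natAdd k) (Fin.natAdd k)) := by
    ext i j
    simp only [X, QSM.opFlip, Matrix.submatrix_apply, Matrix.of_apply, hl]
  have h12 : X.submatrix (Fin.castAdd k) (Fin.natAdd l) =
      QSM.opFlip (Y.submatrix (Fin.castAdd l) (Fin.natAdd k)) := by
    ext i j
    simp only [X, QSM.opFlip, Matrix.submatrix_apply, Matrix.of_apply, hl, hk]
  have h21 : X.submatrix (Fin.natAdd l) (Fin.castAdd k) =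
      QSM.opFlip (Y.submatrix (Fin.natAdd k) (Fin.castAdd l)) := by
    ext i j
    simp only [X, QSM.opFlip, Matrix.submatrix_apply, Matrix.of_apply, hl, hk]
  have h22 : X.submatrix (Fin.natAdd l) (Fin.natAdd l) =
      QSM.opFlip (Y.submatrix (Fin.castAdd l) (Fin.castAdd l)) := by
    ext i j
    simp only [X, QSM.opFlip, Matrix.submatrix_apply, Matrix.of_apply, hk]
  have hschur := hX.detq_schur hq (QSM.opFlip V) (by rw [h11, ← opFlip_mul, hV, opFlip_one])
  rw [h11, h12, h21, h22, ← opFlip_mul, ← opFlip_mul, detq_cast, detq_opFlip, detq_opFlip,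
    ← Matrix.mul_assoc] at hschur
  rw [← MulOpposite.op_inj, MulOpposite.op_mul, hschur, ← detq_opFlip q (_ - _)]
  rfl

lemma detq_fin_zero (q : ℂ) (X : Matrix (Fin 0) (Fin 0) B) : detq q X = 1 := by
  simp [detq, invCount]

lemma rdetq_fin_zero (q : ℂ) (X : Matrix (Fin 0) (Fin 0) B) : rdetq q X = 1 := by
  simp [rdetq, invCount]

lemma Ber_eq (q : ℂ) (r s : ℕ) (X Xinv : Matrix (Fin (r + s)) (Fin (r + s)) B) :
    Ber q r s X Xinv = detq q (X.submatrix (Fin.castAdd s) (Fin.castAdd s)) *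
      rdetq q (Xinv.submatrix (Fin.natAdd r) (Fin.natAdd r)) :=
  rfl

/-- The blocks of mutually inverse matrices in terms of Schur complements. -/
lemma blocks_of_inverse {R a b c : Type*} [Ring R] [Fintype a] [Fintype b] [Fintype c]
    [DecidableEq a] [DecidableEq b] [DecidableEq c] {f : a → c} {g : b → c}
    (hfg : Function.Bijective (Sum.elim f g)) {X Y : Matrix c c R} (hXY : X * Y = 1)
    (hYX : Y * X = 1) {W : Matrix a a R} (hW : X.submatrix f f * W = 1)
    (hW' : W * X.submatrix f f = 1) {S V : Matrix b b R}
    (hS : S = X.submatrix g g - X.submatrix g f * W * X.submatrix f g) (hSV : S * V = 1) :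
    Y.submatrix g g = V ∧ W = Y.submatrix f f - Y.submatrix f g * S * Y.submatrix g f := by
  let e : a ⊕ b ≃ c := Equiv.ofBijective _ hfg
  have hblocks : ∀ Z : Matrix c c R, Z.submatrix e e = Matrix.fromBlocks (Z.submatrix f f)
      (Z.submatrix f g) (Z.submatrix g f) (Z.submatrix g g) := fun Z => by
    ext (i | i) (j | j) <;> rfl
  have key : ∀ {Z Z' : Matrix c c R}, Z * Z' = 1 →
      Matrix.fromBlocks (Z.submatrix f f) (Z.submatrix f g) (Z.submatrix g f) (Z.submatrix g g) *
        Matrix.fromBlocks (Z'.submatrix f f) (Z'.submatrix f g) (Z'.submatrix g f)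
          (Z'.submatrix g g) = Matrix.fromBlocks 1 0 0 1 := fun {Z Z'} h => by
    rw [← hblocks, ← hblocks, Matrix.submatrix_mul_equiv, h, Matrix.submatrix_one_equiv,
      Matrix.fromBlocks_one]
  have h1 := key hXY
  have h2 := key hYX
  rw [Matrix.fromBlocks_multiply, Matrix.fromBlocks_inj] at h1 h2
  obtain ⟨h11, h12, -, -⟩ := h1
  obtain ⟨-, -, k21, k22⟩ := h2
  have hY21 : Y.submatrix g f = -(Y.submatrix g g * X.submatrix g f * W) := by
    rw [← Matrix.mul_one (Y.submatrix g f), ← hW, ← Matrix.mul_assoc,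
      eq_neg_of_add_eq_zero_left k21,
      Matrix.neg_mul]
  have hYS : Y.submatrix g g * S = 1 := by
    rw [hS, ← k22, hY21, Matrix.mul_sub, Matrix.neg_mul, Matrix.mul_assoc _ (X.submatrix g f) W,
      Matrix.mul_assoc _ (X.submatrix g f * W), sub_eq_neg_add]
  have hY12 : Y.submatrix f g = -(W * X.submatrix f g * Y.submatrix g g) := by
    rw [← Matrix.one_mul (Y.submatrix f g), ← hW', Matrix.mul_assoc, eq_neg_of_add_eq_zero_left h12,
      Matrix.mul_neg, Matrix.mul_assoc]
  refine ⟨?_, ?_⟩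
  · rw [← Matrix.mul_one (Y.submatrix g g), ← hSV, ← Matrix.mul_assoc, hYS, Matrix.one_mul]
  · rw [hY12, Matrix.neg_mul, Matrix.mul_assoc _ _ S, hYS, Matrix.mul_one, Matrix.neg_mul,
      sub_neg_eq_add]
    rw [← Matrix.one_mul (Y.submatrix f f), ← hW', Matrix.mul_assoc,
      Matrix.mul_assoc W (X.submatrix f g),
      ← Matrix.mul_add, h11, Matrix.mul_one]

lemma embL_embR_bijective {a b c : ℕ} (h : a + b = c) :
    Function.Bijective (Sum.elim (embL a c (by omega)) (embR a b c (by omega))) := by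
  subst h
  have : Sum.elim (embL a (a + b) (by omega)) (embR a b (a + b) le_rfl) = finSumFinEquiv := by
    ext (i | i) <;> rfl
  rw [this]
  exact finSumFinEquiv.bijective

lemma ManinRel.isQManin_even {q : ℂ} {m n : ℕ} {M : Matrix (Fin (m + n)) (Fin (m + n)) B}
    (hM : ManinRel q m M) : IsQManin q (M.submatrix (Fin.castAdd n) (Fin.castAdd n)) := by
  have hp : ∀ i : Fin m, pa m (Fin.castAdd n i) = 0 := fun i => if_pos i.isLt
  constructor
  · intro i j k
    have := hM.2.2.1 (Fin.castAdd n i) (Fin.castAdd n j) (Fin.castAdd n k) (hp k)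
    rw [hp, zero_mul, pow_zero, mul_one] at this
    exact this
  · intro i j k l
    have := hM.2.2.2 (Fin.castAdd n i) (Fin.castAdd n j) (Fin.castAdd n k) (Fin.castAdd n l)
    simp only [hp, mul_zero, pow_zero, mul_one, add_zero] at this
    exact this

lemma eps_natAdd (m : ℕ) {n : ℕ} (i j : Fin n) :
    eps (Fin.natAdd m i) (Fin.natAdd m j) = eps i j := by
  simp [eps]

lemma ManinRel.isRowQManin_odd {q : ℂ} {m n : ℕ} {N : Matrix (Fin (m + n)) (Fin (m + n)) B}
    (hN : ManinRel q⁻¹ m N) : IsRowQManin q (N.submatrix (Fin.natAdd m) (Fin.natAdd m)) := by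
  have hp : ∀ i : Fin n, pa m (Fin.natAdd m i) = 1 := fun i => if_neg (by simp)
  constructor
  · intro i k l
    have := hN.2.1 (Fin.natAdd m i) (Fin.natAdd m k) (Fin.natAdd m l) (hp i)
    rw [hp, hp, eps_natAdd, inv_zpow', show (-1 : ℂ) ^ ((1 + 1) * (1 + 1)) = 1 by norm_num,
      mul_one] at this
    exact this
  · intro i j k l
    have := hN.2.2.2 (Fin.natAdd m i) (Fin.natAdd m j) (Fin.natAdd m k) (Fin.natAdd m l)
    simp only [hp, eps_natAdd, inv_zpow', show (-1 : ℂ) ^ ((1 + 1) * (1 + 1)) = 1 by norm_num,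
      show (-1 : ℂ) ^ (1 * 1 + 1 * 1 + 1 * 1) = -1 by norm_num, mul_one, mul_neg, neg_smul,
      sub_neg_eq_add] at this
    simp only [Matrix.submatrix_apply]
    rw [this]
    abel

/-- Schur's complement theorem for quantum Berezinians. -/
theorem stmt18 (m n r1 s1 r2 s2 : ℕ) (hr : r1 + r2 = m) (hs : s1 + s2 = n)
    (hcond : s1 = 0 ∨ r2 = 0) (q : ℂ) (hq : q ≠ 0) (A : Type*) [Ring A] [Algebra ℂ A]
    (M Minv : Matrix (Fin (m + n)) (Fin (m + n)) A)
    (hM : ManinRel q m M) (hMinv : ManinRel q⁻¹ m Minv)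
    (h1 : M * Minv = 1) (h2 : Minv * M = 1)
    (W11 : Matrix (Fin (r1 + s1)) (Fin (r1 + s1)) A)
    (hW11 :
      M.submatrix (embL (r1 + s1) (m + n) (by omega)) (embL (r1 + s1) (m + n) (by omega)) *
          W11 = 1 ∧
      W11 * M.submatrix (embL (r1 + s1) (m + n) (by omega))
          (embL (r1 + s1) (m + n) (by omega)) = 1)
    (WS : Matrix (Fin (r2 + s2)) (Fin (r2 + s2)) A)
    (hWS :
      (M.submatrix (embR (r1 + s1) (r2 + s2) (m + n) (by omega))
            (embR (r1 + s1) (r2 + s2) (m + n) (by omega)) -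
          M.submatrix (embR (r1 + s1) (r2 + s2) (m + n) (by omega))
              (embL (r1 + s1) (m + n) (by omega)) * W11 *
            M.submatrix (embL (r1 + s1) (m + n) (by omega))
              (embR (r1 + s1) (r2 + s2) (m + n) (by omega))) * WS = 1 ∧
      WS * (M.submatrix (embR (r1 + s1) (r2 + s2) (m + n) (by omega))
            (embR (r1 + s1) (r2 + s2) (m + n) (by omega)) -
          M.submatrix (embR (r1 + s1) (r2 + s2) (m + n) (by omega))
              (embL (r1 + s1) (m + n) (by omega)) * W11 *
            M.submatrix (embL (r1 + s1) (m + n) (by omega))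
              (embR (r1 + s1) (r2 + s2) (m + n) (by omega))) = 1) :
    Ber q m n M Minv =
      Ber q r1 s1
        (M.submatrix (embL (r1 + s1) (m + n) (by omega)) (embL (r1 + s1) (m + n) (by omega)))
        W11 *
      Ber q r2 s2
        (M.submatrix (embR (r1 + s1) (r2 + s2) (m + n) (by omega))
            (embR (r1 + s1) (r2 + s2) (m + n) (by omega)) -
          M.submatrix (embR (r1 + s1) (r2 + s2) (m + n) (by omega))
              (embL (r1 + s1) (m + n) (by omega)) * W11 *
            M.submatrix (embL (r1 + s1) (m + n) (by omega))
              (embR (r1 + s1) (r2 + s2) (m + n) (by omega))) WS := by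
  have hblocks := blocks_of_inverse (embL_embR_bijective (by omega)) h1 h2 hW11.1 hW11.2 rfl hWS.1
  rcases hcond with hs1 | hr2
  · subst hs1
    obtain rfl : s2 = n := by omega
    subst hr
    have hschur := hM.isQManin_even.detq_schur hq (k := r1) (l := r2) W11 hW11.1
    rw [Ber_eq, Ber_eq, Ber_eq, rdetq_fin_zero, mul_one, hschur, mul_assoc, ← hblocks.1]
    have hodd : Minv.submatrix (Fin.natAdd (r1 + r2)) (Fin.natAdd (r1 + r2)) =
        (Minv.submatrix (embR (r1 + 0) (r2 + s2) (r1 + r2 + s2) (by omega))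
          (embR (r1 + 0) (r2 + s2) (r1 + r2 + s2) (by omega))).submatrix
            (Fin.natAdd r2) (Fin.natAdd r2) := by
      ext i j
      simp only [Matrix.submatrix_apply]
      congr 1 <;> simp [embR, Fin.ext_iff, add_assoc]
    rw [hodd]
    rfl
  · subst hr2
    obtain rfl : r1 = m := by omega
    subst hs
    obtain ⟨hWSeq, hW11eq⟩ := hblocks
    set S := M.submatrix (embR (r1 + s1) (0 + s2) (r1 + (s1 + s2)) (by omega))
            (embR (r1 + s1) (0 + s2) (r1 + (s1 + s2)) (by omega)) -
          M.submatrix (embR (r1 + s1) (0 + s2) (r1 + (s1 + s2)) (by omega))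
              (embL (r1 + s1) (r1 + (s1 + s2)) (by omega)) * W11 *
            M.submatrix (embL (r1 + s1) (r1 + (s1 + s2)) (by omega))
              (embR (r1 + s1) (0 + s2) (r1 + (s1 + s2)) (by omega)) with hS
    let e : Fin s2 ≃ Fin (0 + s2) := finCongr (zero_add s2).symm
    have he : ∀ i, embR (r1 + s1) (0 + s2) (r1 + (s1 + s2)) (by omega) (e i) =
        Fin.natAdd r1 (Fin.natAdd s1 i) := fun i => by
      ext
      simp [embR, e, add_assoc]
    have hnat : ⇑e = Fin.natAdd 0 := by
      ext i
      simp [e]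
    set Y := Minv.submatrix (Fin.natAdd r1) (Fin.natAdd r1) with hY
    have hY22 : Y.submatrix (Fin.natAdd s1) (Fin.natAdd s1) = WS.submatrix e e := by
      rw [← hWSeq]
      ext i j
      simp [hY, he]
    have hW11odd : W11.submatrix (Fin.natAdd r1) (Fin.natAdd r1) =
        Y.submatrix (Fin.castAdd s2) (Fin.castAdd s2) -
          Y.submatrix (Fin.castAdd s2) (Fin.natAdd s1) * S.submatrix e e *
            Y.submatrix (Fin.natAdd s1) (Fin.castAdd s2) := by
      rw [hW11eq, Matrix.submatrix_sub, Pi.sub_apply, Pi.sub_apply,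
        ← Matrix.submatrix_mul_equiv _ _ _ e, ← Matrix.submatrix_mul_equiv _ _ _ e]
      simp only [Matrix.submatrix_submatrix, Function.comp_def, he, hY]
      rfl
    have hschur := hMinv.isRowQManin_odd.rdetq_schur hq (S.submatrix e e) (by
      rw [hY22, Matrix.submatrix_mul_equiv, hWS.1, Matrix.submatrix_one_equiv])
    rw [Ber_eq, Ber_eq, Ber_eq, detq_fin_zero, one_mul, hschur, ← hW11odd, hY22, hnat, mul_assoc]
    rfl

end QSM
end

section
/- (Sylvester's theorem for quantum Berezinians) Let \psi_k = \omega_{k+m|n} \circ \phi_k \circ \omega_{m|n}, where \phi_k: \mathcal{M}_{m|n} \to \mathcal{M}_{k+m|n} sends M_{ij} \mapsto M_{k+i,k+j} and \omega_{m|n} is the anti-isomorphism M \mapsto M^{-1} of \widetilde{\mathcal{M}}_{m|n}. Then \psi_k(Ber_q(M)) = det_q(M^{1,...,k}_{1,...,k})^{-1} \cdot Ber_q(M_{k+m|n}), where M_{k+m|n} is the generator matrix of \mathcal{M}_{k+m|n}. -/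
open scoped BigOperators Classical
open Finset

namespace QSM

variable {B : Type*} [Ring B] [Algebra ℂ B]

/-- A family generating a `q`-Grassmann algebra: `x_i² = 0` and `x_i x_j = c x_j x_i`, `j < i`. -/
structure IsGrassmann {R : Type*} [Ring R] [Algebra ℂ R] (c : ℂ) {N : ℕ} (x : Fin N → R) :
    Prop where
  sq (i : Fin N) : x i * x i = 0
  lt {i j : Fin N} (h : j < i) : x i * x j = c • (x j * x i)

/-- Number of inversions of a list. -/
def listInv {N : ℕ} : List (Fin N) → ℕ
  | [] => 0
  | a :: l => l.countP (· < a) + listInv l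

lemma countP_ofFn_lt {N r : ℕ} (f : Fin r → Fin N) (a : Fin N) :
    (List.ofFn f).countP (· < a) = ∑ i, if f i < a then 1 else 0 := by
  induction r with
  | zero => simp
  | succ r ih =>
    rw [List.ofFn_succ, List.countP_cons, ih fun i => f i.succ, Fin.sum_univ_succ, add_comm]
    simp only [decide_eq_true_eq]

lemma listInv_ofFn {N r : ℕ} (f : Fin r → Fin N) :
    listInv (List.ofFn f)
      = (univ.filter fun p : Fin r × Fin r => p.1 < p.2 ∧ f p.2 < f p.1).card := by
  induction r with
  | zero => simp [listInv]
  | succ r ih =>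
    have h := ih (fun i => f i.succ)
    rw [card_filter, Fintype.sum_prod_type] at h ⊢
    rw [List.ofFn_succ, listInv, h, countP_ofFn_lt]
    simp only [Fin.sum_univ_succ, Fin.succ_pos, Fin.succ_lt_succ_iff, Fin.not_lt_zero,
      true_and, false_and, if_false, zero_add]

section Grassmann

variable {R : Type*} [Ring R] [Algebra ℂ R] {c : ℂ} {N : ℕ} {x : Fin N → R}

lemma IsGrassmann.comp_strictMono (hx : IsGrassmann c x) {r : ℕ} {e : Fin r → Fin N}
    (he : StrictMono e) : IsGrassmann c (x ∘ e) :=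
  ⟨fun i => hx.sq (e i), fun h => hx.lt (he h)⟩

lemma IsGrassmann.exists_swap (hx : IsGrassmann c x) (hc : c ≠ 0) (i j : Fin N) :
    ∃ d : ℂ, x i * x j = d • (x j * x i) := by
  rcases lt_trichotomy i j with h | rfl | h
  · exact ⟨c⁻¹, by rw [hx.lt h, smul_smul, inv_mul_cancel₀ hc, one_smul]⟩
  · exact ⟨1, by simp⟩
  · exact ⟨c, hx.lt h⟩

lemma IsGrassmann.mul_prod_eq_zero (hx : IsGrassmann c x) (hc : c ≠ 0) {a : Fin N}
    {l : List (Fin N)} (ha : a ∈ l) : x a * (l.map x).prod = 0 := by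
  induction l with
  | nil => simp at ha
  | cons b l ih =>
    rw [List.map_cons, List.prod_cons, ← mul_assoc]
    rcases List.mem_cons.1 ha with rfl | h
    · rw [hx.sq, zero_mul]
    · obtain ⟨d, hd⟩ := hx.exists_swap hc a b
      rw [hd, smul_mul_assoc, mul_assoc, ih h, mul_zero, smul_zero]

lemma IsGrassmann.prod_eq_zero (hx : IsGrassmann c x) (hc : c ≠ 0) {l : List (Fin N)}
    (hl : ¬ l.Nodup) : (l.map x).prod = 0 := by
  induction l with
  | nil => simp at hl
  | cons b l ih =>
    by_cases hb : b ∈ l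
    · simpa using hx.mul_prod_eq_zero hc hb
    · rw [List.nodup_cons, not_and] at hl
      rw [List.map_cons, List.prod_cons, ih (hl hb), mul_zero]

lemma IsGrassmann.mul_prod_orderedInsert (hx : IsGrassmann c x) (a : Fin N)
    {l : List (Fin N)} (hl : l.Pairwise (· ≤ ·)) :
    x a * (l.map x).prod
      = c ^ l.countP (· < a) • ((l.orderedInsert (· ≤ ·) a).map x).prod := by
  induction l with
  | nil => simp
  | cons b l ih =>
    rw [List.pairwise_cons] at hl
    by_cases hab : a ≤ b
    · have h0 : (b :: l).countP (· < a) = 0 := by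
        rw [List.countP_eq_zero]
        intro i hi
        rcases List.mem_cons.1 hi with rfl | hi
        · simpa using hab
        · simpa using hab.trans (hl.1 i hi)
      rw [h0, List.orderedInsert_cons, if_pos hab]
      simp
    · rw [List.orderedInsert_cons, if_neg hab, List.map_cons, List.prod_cons, ← mul_assoc,
        hx.lt (not_le.1 hab), smul_mul_assoc, mul_assoc, ih hl.2, mul_smul_comm, smul_smul,
        List.countP_cons, List.map_cons, List.prod_cons]
      simp [not_le.1 hab, pow_succ']

lemma IsGrassmann.prod_insertionSort (hx : IsGrassmann c x) (l : List (Fin N)) :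
    (l.map x).prod = c ^ listInv l • ((l.insertionSort (· ≤ ·)).map x).prod := by
  induction l with
  | nil => simp [listInv]
  | cons a l ih =>
    rw [List.map_cons, List.prod_cons, ih, mul_smul_comm,
      hx.mul_prod_orderedInsert a (List.pairwise_insertionSort _ l),
      (List.perm_insertionSort _ l).countP_eq, smul_smul, listInv, List.insertionSort_cons,
      pow_add, mul_comm]

lemma IsGrassmann.prod_perm (hx : IsGrassmann c x) (σ : Equiv.Perm (Fin N)) :
    (List.ofFn fun i => x (σ i)).prod = c ^ invCount σ • (List.ofFn x).prod := by
  have h := hx.prod_insertionSort (List.ofFn σ)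
  have hs : (List.ofFn σ).insertionSort (· ≤ ·) = List.ofFn id := by
    refine List.Perm.eq_of_sortedLE List.sortedLE_insertionSort ?_ ?_
    · exact List.sortedLE_ofFn_iff.2 monotone_id
    · exact (List.perm_insertionSort _ _).trans (Equiv.Perm.ofFn_comp_perm σ id)
  rw [hs, listInv_ofFn, List.map_ofFn, List.map_ofFn] at h
  exact h

end Grassmann

lemma prod_ofFn_sum {R : Type*} [Ring R] {I : Type*} [Fintype I] {r : ℕ} (g : I → Fin r → R) :
    (List.ofFn fun j => ∑ i, g i j).prod
      = ∑ f : Fin r → I, (List.ofFn fun j => g (f j) j).prod := by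
  induction r with
  | zero => simp
  | succ r ih =>
    rw [List.ofFn_succ, List.prod_cons, ih fun i j => g i j.succ, sum_mul_sum,
      ← Fintype.sum_prod_type', ← (Fin.consEquiv fun _ => I).sum_comp]
    simp [List.ofFn_succ, Fin.consEquiv]

section Expansion

variable {R : Type*} [Ring R] [Algebra ℂ R] {c : ℂ} {N : ℕ} {x : Fin N → R} {ι : B →ₐ[ℂ] R}

lemma prod_ofFn_map_mul {I : Type*} {y : I → R} (hι : ∀ i b, y i * ι b = ι b * y i) {r : ℕ}
    (a : Fin r → B) (f : Fin r → I) :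
    (List.ofFn fun j => ι (a j) * y (f j)).prod
      = ι (List.ofFn a).prod * (List.ofFn fun j => y (f j)).prod := by
  induction r with
  | zero => simp
  | succ r ih =>
    simp only [List.ofFn_succ, List.prod_cons, ih, map_mul]
    rw [mul_assoc, ← mul_assoc (y (f 0)), hι]
    simp only [mul_assoc]

lemma prod_ofFn_mul_map {I : Type*} {y : I → R} (hι : ∀ i b, y i * ι b = ι b * y i) {r : ℕ}
    (f : Fin r → I) (b : B) :
    (List.ofFn (y ∘ f)).prod * ι b = ι b * (List.ofFn (y ∘ f)).prod := by
  refine (Commute.list_prod_left _ _ ?_).eq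
  intro z hz
  obtain ⟨j, rfl⟩ := (List.mem_ofFn' _ _).1 hz
  exact hι _ b

/-- Products of generic linear forms produce quantum determinants: if `Z` kills every monomial
that is not a rearrangement of `x ∘ e`, only `detq` of the rows `e` survives. -/
lemma prod_ofFn_linear_mul (hx : IsGrassmann c x) (hι : ∀ i b, x i * ι b = ι b * x i)
    {q : ℂ} (hcq : c = (-q)⁻¹) {r : ℕ} (P : Matrix (Fin N) (Fin r) B) {e : Fin r → Fin N}
    (he : StrictMono e) (Z : R)
    (hZ : ∀ f : Fin r → Fin N, (¬ ∃ σ : Equiv.Perm (Fin r), f = e ∘ σ) →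
      (List.ofFn (x ∘ f)).prod * Z = 0) :
    (List.ofFn fun j => ∑ i, ι (P i j) * x i).prod * Z
      = ι (detq q (P.submatrix e id)) * ((List.ofFn (x ∘ e)).prod * Z) := by
  have hinj : Function.Injective fun σ : Equiv.Perm (Fin r) => e ∘ σ := fun σ τ h =>
    Equiv.ext fun i => he.injective (congrFun h i)
  rw [prod_ofFn_sum fun i j => ι (P i j) * x i, sum_mul]
  have hterm (f : Fin r → Fin N) :
      (List.ofFn fun j => ι (P (f j) j) * x (f j)).prod * Z
        = ι (List.ofFn fun j => P (f j) j).prod * ((List.ofFn (x ∘ f)).prod * Z) := by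
    rw [prod_ofFn_map_mul hι (fun j => P (f j) j) f, mul_assoc]
    rfl
  rw [← Fintype.sum_of_injective _ hinj (fun σ : Equiv.Perm (Fin r) =>
    ι (List.ofFn fun j => P (e (σ j)) j).prod * ((List.ofFn (x ∘ e ∘ σ)).prod * Z)) _ ?_ ?_]
  · rw [detq, map_sum, sum_mul]
    refine sum_congr rfl fun σ _ => ?_
    have hσ : (List.ofFn (x ∘ e ∘ σ)).prod = c ^ invCount σ • (List.ofFn (x ∘ e)).prod :=
      (hx.comp_strictMono he).prod_perm σ
    rw [hσ, map_smul, smul_mul_assoc, smul_mul_assoc, mul_smul_comm, hcq, inv_pow, zpow_neg,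
      zpow_natCast]
    rfl
  · intro f hf
    rw [hterm, hZ f fun ⟨σ, h⟩ => hf ⟨σ, h.symm⟩, mul_zero]
  · intro σ
    exact (hterm _).symm

lemma prod_ofFn_linear (hx : IsGrassmann c x) (hι : ∀ i b, x i * ι b = ι b * x i)
    {q : ℂ} (hq : q ≠ 0) (hcq : c = (-q)⁻¹) (P : Matrix (Fin N) (Fin N) B) :
    (List.ofFn fun j => ∑ i, ι (P i j) * x i).prod = ι (detq q P) * (List.ofFn x).prod := by
  have h := prod_ofFn_linear_mul hx hι hcq P strictMono_id 1 fun f hf => by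
    have hinj : ¬ Function.Injective f := fun hinj =>
      hf ⟨Equiv.ofBijective f (Finite.injective_iff_bijective.1 hinj), rfl⟩
    rw [← List.map_ofFn, hx.prod_eq_zero (hcq ▸ inv_ne_zero (neg_ne_zero.2 hq))
      fun h => hinj (List.nodup_ofFn.1 h), zero_mul]
  simpa using h

lemma sum_sum_eq_zero_of_antisymm {I : Type*} [Fintype I] [LinearOrder I] (T : I → I → R)
    (hdiag : ∀ a, T a a = 0) (hlt : ∀ a b, a < b → T a b + T b a = 0) :
    ∑ a, ∑ b, T a b = 0 := by
  have hanti (a b : I) : T a b + T b a = 0 := by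
    rcases lt_trichotomy a b with h | rfl | h
    · exact hlt a b h
    · rw [hdiag, add_zero]
    · rw [add_comm]; exact hlt b a h
  have h2 : (2 : ℂ) • ∑ a, ∑ b, T a b = 0 := by
    rw [two_smul]
    nth_rewrite 2 [sum_comm]
    simp_rw [← sum_add_distrib, hanti, sum_const_zero]
  exact (smul_eq_zero_iff_right two_ne_zero).1 h2

/-- The linear forms attached to the columns of a (purely even) `q`-Manin matrix again generate
a `q`-Grassmann algebra. -/
lemma IsGrassmann.linear (hx : IsGrassmann c x) (hι : ∀ i b, x i * ι b = ι b * x i)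
    {q : ℂ} (hq : q ≠ 0) (hcq : c = (-q)⁻¹) {r : ℕ} (P : Matrix (Fin N) (Fin r) B)
    (hcol : ∀ i j k, P i k * P j k = q ^ eps i j • (P j k * P i k))
    (hcross : ∀ i j k l, P i j * P k l - q ^ (eps i k + eps l j) • (P k l * P i j)
      = q ^ eps i k • (P k j * P i l) - q ^ eps l j • (P i l * P k j)) :
    IsGrassmann c fun j => ∑ i, ι (P i j) * x i := by
  have hmul (j l : Fin r) : (∑ i, ι (P i j) * x i) * (∑ i, ι (P i l) * x i)
      = ∑ a, ∑ b, ι (P a j * P b l) * (x a * x b) := by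
    rw [sum_mul_sum]
    refine sum_congr rfl fun a _ => sum_congr rfl fun b _ => ?_
    rw [mul_assoc, ← mul_assoc (x a), hι, map_mul]
    simp only [mul_assoc]
  constructor
  · intro j
    rw [hmul]
    apply sum_sum_eq_zero_of_antisymm
    · intro a
      rw [hx.sq, mul_zero]
    · intro a b hab
      have he : eps b a = 1 := by simp [eps, hab]
      rw [hx.lt hab, hcol b a, he, hcq, zpow_one]
      simp only [map_smul, smul_mul_assoc, mul_smul_comm, smul_smul]
      match_scalars
      field_simp
      ring
  · intro j l hlj
    rw [← sub_eq_zero, hmul, hmul, smul_sum, ← sum_sub_distrib]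
    simp_rw [smul_sum, ← sum_sub_distrib]
    apply sum_sum_eq_zero_of_antisymm
    · intro a
      rw [hx.sq, mul_zero, mul_zero, smul_zero, sub_zero]
    · intro a b hab
      have h1 : eps a b = -1 := by simp [eps, hab, hab.not_gt]
      have h2 : eps j l = 1 := by simp [eps, hlj]
      have h := congrArg (fun z => ι z * (x a * x b)) (hcross a l b j)
      simp only [h1, h2, map_sub, map_smul, sub_mul, smul_mul_assoc, zpow_neg, zpow_one,
        neg_add_cancel, zpow_zero, one_smul] at h
      simp only [hx.lt hab, mul_smul_comm, smul_smul]
      rw [hcq]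
      linear_combination (norm := skip) (q⁻¹ : ℂ) • h
      match_scalars <;> field_simp <;> ring

end Expansion

section Representation

variable (B) in
/-- The `i`-th generator of the `q`-Grassmann algebra, acting on functions on finite sets. -/
noncomputable def creation (c : ℂ) {N : ℕ} (i : Fin N) :
    Module.End ℂ (Finset (Fin N) → B) where
  toFun f S := if i ∈ S then c ^ (S.filter (· < i)).card • f (S.erase i) else 0
  map_add' f g := by
    ext S
    by_cases h : i ∈ S <;> simp [h]
  map_smul' d f := by
    ext S
    by_cases h : i ∈ S <;> simp [h, smul_comm d]

lemma creation_apply (c : ℂ) {N : ℕ} (i : Fin N) (f : Finset (Fin N) → B) (S : Finset (Fin N)) :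
    creation B c i f S = if i ∈ S then c ^ (S.filter (· < i)).card • f (S.erase i) else 0 :=
  rfl

lemma isGrassmann_creation (c : ℂ) (N : ℕ) :
    IsGrassmann c (creation B c : Fin N → Module.End ℂ (Finset (Fin N) → B)) := by
  constructor
  · intro i
    refine LinearMap.ext fun f => funext fun S => ?_
    simp [creation_apply]
  · intro i j hji
    refine LinearMap.ext fun f => funext fun S => ?_
    simp only [Module.End.mul_apply, LinearMap.smul_apply, Pi.smul_apply, creation_apply]
    by_cases hi : i ∈ S <;> by_cases hj : j ∈ S <;> simp [hi, hj, hji.ne, hji.ne']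
    have h1 : ((S.erase i).filter (· < j)) = S.filter (· < j) := by
      ext a
      simp only [mem_filter, mem_erase]
      exact ⟨fun h => ⟨h.1.2, h.2⟩, fun h => ⟨⟨(h.2.trans hji).ne, h.1⟩, h.2⟩⟩
    have h2 : (S.filter (· < i)).card = ((S.erase j).filter (· < i)).card + 1 := by
      have hmem : j ∈ S.filter (· < i) := mem_filter.2 ⟨hj, hji⟩
      rw [← card_erase_add_one hmem, filter_erase]
    rw [h1, h2, erase_right_comm, smul_smul, smul_smul, smul_smul]
    congr 1
    ring

lemma creation_mul_lsmul (c : ℂ) {N : ℕ} (i : Fin N) (b : B) :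
    creation B c i * Algebra.lsmul ℂ ℂ (Finset (Fin N) → B) b
      = Algebra.lsmul ℂ ℂ (Finset (Fin N) → B) b * creation B c i := by
  refine LinearMap.ext fun f => funext fun S => ?_
  by_cases h : i ∈ S <;> simp [creation_apply, h]

lemma prod_creation_apply (c : ℂ) {N : ℕ} {l : List (Fin N)} (hl : l.Nodup) :
    ∃ d : ℕ, ∀ f : Finset (Fin N) → B,
      (l.map (creation B c)).prod f l.toFinset = c ^ d • f ∅ := by
  induction l with
  | nil => exact ⟨0, fun f => by simp⟩
  | cons a l ih =>
    rw [List.nodup_cons] at hl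
    obtain ⟨d, hd⟩ := ih hl.2
    refine ⟨((a :: l).toFinset.filter (· < a)).card + d, fun f => ?_⟩
    have he : (a :: l).toFinset.erase a = l.toFinset := by
      simp [List.toFinset_cons, hl.1]
    rw [List.map_cons, List.prod_cons, Module.End.mul_apply, creation_apply, if_pos (by simp), he,
      hd, smul_smul, pow_add]

/-- Coefficients of the top monomial of the `q`-Grassmann algebra can be compared. -/
lemma lsmul_mul_top_injective {c : ℂ} (hc : c ≠ 0) (N : ℕ) {a b : B}
    (h : Algebra.lsmul ℂ ℂ (Finset (Fin N) → B) a * (List.ofFn (creation B c)).prod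
      = Algebra.lsmul ℂ ℂ (Finset (Fin N) → B) b * (List.ofFn (creation B c)).prod) : a = b := by
  obtain ⟨d, hd⟩ := prod_creation_apply (B := B) c (List.nodup_finRange N)
  have h' := congrFun (congrArg (fun T => T (1 : Finset (Fin N) → B)) h) (List.finRange N).toFinset
  rw [← List.ofFn_id, List.map_ofFn] at hd
  simp only [Module.End.mul_apply, Algebra.lsmul_coe, Pi.smul_apply] at h'
  rw [← List.ofFn_id] at h'
  erw [hd] at h'
  simpa [hc] using h'

end Representation


/-- The Schur complement formula for the quantum determinant of a `q`-Manin matrix. -/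
lemma detq_eq_detq_mul_detq_schur {q : ℂ} (hq : q ≠ 0) {k m : ℕ}
    (P : Matrix (Fin (k + m)) (Fin (k + m)) B)
    (hcol : ∀ i j k, P i k * P j k = q ^ eps i j • (P j k * P i k))
    (hcross : ∀ i j k l, P i j * P k l - q ^ (eps i k + eps l j) • (P k l * P i j)
      = q ^ eps i k • (P k j * P i l) - q ^ eps l j • (P i l * P k j))
    (W : Matrix (Fin k) (Fin k) B)
    (hW : P.submatrix (Fin.castAdd m) (Fin.castAdd m) * W = 1) :
    detq q P = detq q (P.submatrix (Fin.castAdd m) (Fin.castAdd m)) *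
      detq q (P.submatrix (Fin.natAdd k) (Fin.natAdd k) -
        P.submatrix (Fin.natAdd k) (Fin.castAdd m) * W *
          P.submatrix (Fin.castAdd m) (Fin.natAdd k)) := by
  set S := P.submatrix (Fin.natAdd k) (Fin.natAdd k) -
        P.submatrix (Fin.natAdd k) (Fin.castAdd m) * W *
          P.submatrix (Fin.castAdd m) (Fin.natAdd k) with hS
  set c : ℂ := (-q)⁻¹ with hc
  have hc0 : c ≠ 0 := inv_ne_zero (neg_ne_zero.2 hq)
  apply lsmul_mul_top_injective hc0 (k + m)
  set ι := Algebra.lsmul ℂ ℂ (A := B) (Finset (Fin (k + m)) → B)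
  set x : Fin (k + m) → Module.End ℂ (Finset (Fin (k + m)) → B) := creation B c
  have hx : IsGrassmann c x := isGrassmann_creation c _
  have hι : ∀ i b, x i * ι b = ι b * x i := creation_mul_lsmul c
  set ψ := fun j => ∑ i, ι (P i j) * x i with hψ
  have hψG : IsGrassmann c ψ := hx.linear hι hq hc P hcol hcross
  set θ := fun j : Fin m => ∑ i, ι (S i j) * x (Fin.natAdd k i) with hθ
  set C := W * P.submatrix (Fin.castAdd m) (Fin.natAdd k) with hC
  have hψθ (j : Fin m) :
      ψ (Fin.natAdd k j) = θ j + ∑ l, ψ (Fin.castAdd m l) * ι (C l j) := by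
    have h1 : ∑ l, ψ (Fin.castAdd m l) * ι (C l j)
        = ∑ i, ι ((P.submatrix id (Fin.castAdd m) * C) i j) * x i := by
      simp only [hψ, Matrix.mul_apply, map_sum, sum_mul]
      rw [sum_comm]
      refine sum_congr rfl fun i _ => sum_congr rfl fun l _ => ?_
      rw [mul_assoc, hι, map_mul, mul_assoc]
      rfl
    have h2 (i : Fin k) : (P.submatrix id (Fin.castAdd m) * C) (Fin.castAdd m i) j
        = P (Fin.castAdd m i) (Fin.natAdd k j) := by
      have h : P.submatrix (Fin.castAdd m) (Fin.castAdd m) * C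
          = P.submatrix (Fin.castAdd m) (Fin.natAdd k) := by
        rw [hC, ← Matrix.mul_assoc, hW, Matrix.one_mul]
      exact congrFun (congrFun h i) j
    have h3 (i : Fin m) : P (Fin.natAdd k i) (Fin.natAdd k j)
        = S i j + (P.submatrix id (Fin.castAdd m) * C) (Fin.natAdd k i) j := by
      have h : P.submatrix (Fin.natAdd k) (Fin.natAdd k)
          = S + P.submatrix (Fin.natAdd k) (Fin.castAdd m) * C := by
        rw [hS, hC, Matrix.mul_assoc, sub_add_cancel]
      exact congrFun (congrFun h i) j
    rw [h1]
    simp only [hψ, hθ, Fin.sum_univ_add, h2, h3, map_add, add_mul, sum_add_distrib]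
    abel
  have hreplace (l : List (Fin m)) (p : List (Fin (k + m))) (hp : ∀ i, Fin.castAdd m i ∈ p) :
      (p.map ψ).prod * (l.map fun j => ψ (Fin.natAdd k j)).prod
        = (p.map ψ).prod * (l.map θ).prod := by
    induction l generalizing p with
    | nil => simp
    | cons b l ih =>
      have hb : (p.map ψ).prod * ψ (Fin.natAdd k b) = (p.map ψ).prod * θ b := by
        rw [hψθ, mul_add, add_eq_left, mul_sum]
        refine sum_eq_zero ?_
        intro i _
        have h0 : ((p ++ [Fin.castAdd m i]).map ψ).prod = 0 :=
          hψG.prod_eq_zero hc0 fun h => by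
            simpa using (List.nodup_append.1 h).2.2 _ (hp i)
        rw [List.map_append, List.prod_append, List.map_singleton, List.prod_singleton] at h0
        rw [← mul_assoc, h0, zero_mul]
      have h := ih (p ++ [Fin.natAdd k b]) fun i => List.mem_append_left _ (hp i)
      rw [List.map_append, List.prod_append, List.map_singleton, List.prod_singleton] at h
      rw [List.map_cons, List.map_cons, List.prod_cons, List.prod_cons, ← mul_assoc, ← mul_assoc,
        h, hb]
  set X₂ := (List.ofFn fun j : Fin m => x (Fin.natAdd k j)).prod with hX₂
  have hθprod : (List.ofFn θ).prod = ι (detq q S) * X₂ :=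
    prod_ofFn_linear (hx.comp_strictMono (Fin.strictMono_natAdd k))
      (fun i b => hι _ b) hq hc S
  have hψprod : (List.ofFn ψ).prod = ι (detq q P) * (List.ofFn x).prod :=
    prod_ofFn_linear hx hι hq hc P
  have hψ₁ : (List.ofFn fun i : Fin k => ψ (Fin.castAdd m i)).prod * (ι (detq q S) * X₂)
      = ι (detq q (P.submatrix (Fin.castAdd m) (Fin.castAdd m))) *
        ((List.ofFn (x ∘ Fin.castAdd m)).prod * (ι (detq q S) * X₂)) := by
    refine prod_ofFn_linear_mul hx hι hc (P.submatrix id (Fin.castAdd m))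
      (fun _ _ h => h) (ι (detq q S) * X₂) fun f hf => ?_
    rw [← mul_assoc, prod_ofFn_mul_map hι, mul_assoc]
    have h0 : ((List.ofFn f ++ List.ofFn (Fin.natAdd k : Fin m → _)).map x).prod = 0 := by
      refine hx.prod_eq_zero hc0 fun hnd => hf ?_
      rw [List.nodup_append] at hnd
      have hmem (i : Fin k) : ∃ a, f i = Fin.castAdd m a := by
        have h : ∀ z, z = f i → ∃ a, z = Fin.castAdd m a := fun z => by
          refine Fin.addCases (fun a _ => ⟨a, rfl⟩) (fun a ha => ?_) z
          exact absurd ha.symm (hnd.2.2 _ (List.mem_ofFn.2 ⟨i, rfl⟩) _ (List.mem_ofFn.2 ⟨a, rfl⟩))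
        exact h _ rfl
      choose σ hσ using hmem
      have hσi : Function.Injective σ := fun i j hij =>
        List.nodup_ofFn.1 hnd.1 (by rw [hσ, hσ, hij])
      exact ⟨Equiv.ofBijective σ (Finite.injective_iff_bijective.1 hσi), funext hσ⟩
    rw [List.map_append, List.prod_append, List.map_ofFn, List.map_ofFn] at h0
    exact (congrArg (ι (detq q S) * ·) h0).trans (mul_zero _)
  have hsplit : (List.ofFn ψ).prod
      = (List.ofFn fun i : Fin k => ψ (Fin.castAdd m i)).prod * (List.ofFn θ).prod := by
    have h := hreplace (List.finRange m) (List.ofFn (Fin.castAdd m : Fin k → _)) fun i =>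
      List.mem_ofFn.2 ⟨i, rfl⟩
    rw [← List.ofFn_id, List.map_ofFn, List.map_ofFn, List.map_ofFn] at h
    rw [List.ofFn_add, List.prod_append]
    exact h
  have hx_split : (List.ofFn x).prod = (List.ofFn (x ∘ Fin.castAdd m)).prod * X₂ := by
    rw [List.ofFn_add, List.prod_append]
    rfl
  rw [← hψprod, hsplit, hθprod, hψ₁, hx_split, map_mul, ← mul_assoc (List.prod _),
    prod_ofFn_mul_map hι]
  simp only [mul_assoc]

lemma mul_submatrix_corner {T : Type*} [Ring T] {N k s : ℕ} (hN : N = k + s)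
    (X Y : Matrix (Fin N) (Fin N) T)
    {I J : Type*} (f : I → Fin N) (g : J → Fin N) :
    (X * Y).submatrix f g
      = X.submatrix f (embL k N (by omega)) * Y.submatrix (embL k N (by omega)) g +
        X.submatrix f (embR k s N (by omega)) * Y.submatrix (embR k s N (by omega)) g := by
  subst hN
  ext i j
  simp only [Matrix.submatrix_apply, Matrix.add_apply, Matrix.mul_apply, Fin.sum_univ_add]
  rfl

/-- The inverse of the Schur complement is the corresponding block of the inverse matrix. -/
lemma schur_inv_eq_submatrix {T : Type*} [Ring T] {N k s : ℕ} (hN : N = k + s)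
    (X Y : Matrix (Fin N) (Fin N) T)
    (hYX : Y * X = 1) (W : Matrix (Fin k) (Fin k) T)
    (hW : X.submatrix (embL k N (by omega)) (embL k N (by omega)) * W = 1)
    (WS : Matrix (Fin s) (Fin s) T)
    (hWS : (X.submatrix (embR k s N (by omega)) (embR k s N (by omega)) -
      X.submatrix (embR k s N (by omega)) (embL k N (by omega)) * W *
        X.submatrix (embL k N (by omega)) (embR k s N (by omega))) * WS = 1) :
    WS = Y.submatrix (embR k s N (by omega)) (embR k s N (by omega)) := by
  have hR : Function.Injective (embR k s N (by omega)) := fun a b h => by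
    simpa [embR, Fin.ext_iff] using h
  have hRR := mul_submatrix_corner hN Y X (embR k s N (by omega)) (embR k s N (by omega))
  have hRL := mul_submatrix_corner hN Y X (embR k s N (by omega)) (embL k N (by omega))
  rw [hYX, Matrix.submatrix_one _ hR] at hRR
  have h0 : (1 : Matrix (Fin N) (Fin N) T).submatrix (embR k s N (by omega))
      (embL k N (by omega)) = 0 := by
    ext i j
    refine Matrix.one_apply_ne fun h => ?_
    have := congrArg Fin.val h
    simp only [embR, embL] at this
    omega
  rw [hYX, h0] at hRL
  set X11 := X.submatrix (embL k N (by omega)) (embL k N (by omega))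
  set X12 := X.submatrix (embL k N (by omega)) (embR k s N (by omega))
  set X21 := X.submatrix (embR k s N (by omega)) (embL k N (by omega))
  set X22 := X.submatrix (embR k s N (by omega)) (embR k s N (by omega))
  set Y21 := Y.submatrix (embR k s N (by omega)) (embL k N (by omega))
  set Y22 := Y.submatrix (embR k s N (by omega)) (embR k s N (by omega))
  have h1 : Y21 = -(Y22 * X21 * W) := by
    calc Y21 = Y21 * (X11 * W) := by rw [hW, Matrix.mul_one]
      _ = (Y21 * X11) * W := by rw [Matrix.mul_assoc]
      _ = _ := by rw [eq_neg_of_add_eq_zero_left hRL.symm, Matrix.neg_mul]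
  have h2 : Y22 * (X22 - X21 * W * X12) = 1 := by
    rw [hRR, h1, Matrix.mul_sub, Matrix.neg_mul, neg_add_eq_sub]
    simp only [Matrix.mul_assoc]
  calc WS = Y22 * (X22 - X21 * W * X12) * WS := by rw [h2, Matrix.one_mul]
    _ = Y22 := by rw [Matrix.mul_assoc, hWS, Matrix.mul_one]

/-- Sylvester's theorem for quantum Berezinians. -/
theorem stmt19 (k m n : ℕ) (q : ℂ) (hq : q ≠ 0) (A : Type*) [Ring A] [Algebra ℂ A]
    (Mb Mbinv : Matrix (Fin (k + m + n)) (Fin (k + m + n)) A)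
    (hMb : ManinRel q (k + m) Mb) (hMbinv : ManinRel q⁻¹ (k + m) Mbinv)
    (h1 : Mb * Mbinv = 1) (h2 : Mbinv * Mb = 1)
    (W11 : Matrix (Fin k) (Fin k) A)
    (hW11 :
      Mb.submatrix (embL k (k + m + n) (by omega)) (embL k (k + m + n) (by omega)) * W11 = 1 ∧
      W11 * Mb.submatrix (embL k (k + m + n) (by omega)) (embL k (k + m + n) (by omega)) = 1)
    (WS : Matrix (Fin (m + n)) (Fin (m + n)) A)
    (hWS :
      (Mb.submatrix (embR k (m + n) (k + m + n) (by omega))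
            (embR k (m + n) (k + m + n) (by omega)) -
          Mb.submatrix (embR k (m + n) (k + m + n) (by omega))
              (embL k (k + m + n) (by omega)) * W11 *
            Mb.submatrix (embL k (k + m + n) (by omega))
              (embR k (m + n) (k + m + n) (by omega))) * WS = 1 ∧
      WS * (Mb.submatrix (embR k (m + n) (k + m + n) (by omega))
            (embR k (m + n) (k + m + n) (by omega)) -
          Mb.submatrix (embR k (m + n) (k + m + n) (by omega))
              (embL k (k + m + n) (by omega)) * W11 *
            Mb.submatrix (embL k (k + m + n) (by omega))
              (embR k (m + n) (k + m + n) (by omega))) = 1)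
    (Dinv : A)
    (hD : Dinv * detq q (Mb.submatrix (embL k (k + m + n) (by omega))
            (embL k (k + m + n) (by omega))) = 1 ∧
          detq q (Mb.submatrix (embL k (k + m + n) (by omega))
            (embL k (k + m + n) (by omega))) * Dinv = 1) :
    Ber q m n
        (Mb.submatrix (embR k (m + n) (k + m + n) (by omega))
            (embR k (m + n) (k + m + n) (by omega)) -
          Mb.submatrix (embR k (m + n) (k + m + n) (by omega))
              (embL k (k + m + n) (by omega)) * W11 *
            Mb.submatrix (embL k (k + m + n) (by omega))
              (embR k (m + n) (k + m + n) (by omega))) WS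
      = Dinv * Ber q (k + m) n Mb Mbinv := by
  set S := Mb.submatrix (embR k (m + n) (k + m + n) (by omega))
            (embR k (m + n) (k + m + n) (by omega)) -
          Mb.submatrix (embR k (m + n) (k + m + n) (by omega))
              (embL k (k + m + n) (by omega)) * W11 *
            Mb.submatrix (embL k (k + m + n) (by omega))
              (embR k (m + n) (k + m + n) (by omega)) with hS
  set P := Mb.submatrix (Fin.castAdd n) (Fin.castAdd n) with hP
  have hpa (i : Fin (k + m)) : pa (k + m) (Fin.castAdd n i) = 0 := if_pos i.isLt
  have hcol (i j l : Fin (k + m)) : P i l * P j l = q ^ eps i j • (P j l * P i l) := by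
    have h := hMb.2.2.1 (Fin.castAdd n i) (Fin.castAdd n j) (Fin.castAdd n l) (hpa l)
    rw [hpa, hpa, mul_zero, pow_zero, mul_one] at h
    exact h
  have hcross (i j a l : Fin (k + m)) : P i j * P a l - q ^ (eps i a + eps l j) • (P a l * P i j)
      = q ^ eps i a • (P a j * P i l) - q ^ eps l j • (P i l * P a j) := by
    have h := hMb.2.2.2 (Fin.castAdd n i) (Fin.castAdd n j) (Fin.castAdd n a) (Fin.castAdd n l)
    simp only [hpa, mul_zero, add_zero, pow_zero, mul_one] at h
    exact h
  have hdet := detq_eq_detq_mul_detq_schur hq P hcol hcross W11 hW11.1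
  have hWSeq : WS = Mbinv.submatrix (embR k (m + n) (k + m + n) (by omega))
      (embR k (m + n) (k + m + n) (by omega)) :=
    schur_inv_eq_submatrix (add_assoc k m n) Mb Mbinv h2 W11 hW11.1 WS hWS.1
  have hidx (j : Fin n) : embR k (m + n) (k + m + n) (by omega) (Fin.natAdd m j)
      = Fin.natAdd (k + m) j := Fin.ext (by simp [embR, add_assoc])
  have hodd : (∑ ρ : Equiv.Perm (Fin n), ((-q) ^ (-(invCount ρ : ℤ))) •
        (List.ofFn fun j : Fin n => WS (Fin.natAdd m j) (Fin.natAdd m (ρ j))).prod)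
      = ∑ ρ : Equiv.Perm (Fin n), ((-q) ^ (-(invCount ρ : ℤ))) •
        (List.ofFn fun j : Fin n => Mbinv (Fin.natAdd (k + m) j) (Fin.natAdd (k + m) (ρ j))).prod := by
    simp only [hWSeq, Matrix.submatrix_apply, hidx]
  change detq q (S.submatrix (Fin.castAdd n) (Fin.castAdd n)) * _ = Dinv * (detq q P * _)
  rw [hodd, hdet, ← mul_assoc Dinv, ← mul_assoc Dinv]
  have hP11 : P.submatrix (Fin.castAdd m) (Fin.castAdd m)
      = Mb.submatrix (embL k (k + m + n) (by omega)) (embL k (k + m + n) (by omega)) := rfl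
  rw [hP11, hD.1, one_mul]
  rfl

end QSM
end
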